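/- Let ε ∈ (0,1) and let ℓ be an integer satisfying ⌈(log(ℓ)+1)²⌉ < ⌈ℓ^ε⌉ ≤ ℓ − 2⌈log(ℓ)⌉. Let F be a finite field of odd order, set n = 2ℓ+1, and let H be the special orthogonal group of n×n matrices M over F satisfying Mᵀ·M = I and det(M) = 1 (the orthogonal group of the standard symmetric bilinear form, intersected with SL_n(F)). Then the proportion of elements h ∈ H such that h has even order and h^{|h|/2} is an involution whose (−1)-eigenspace has dimension at most 2⌈ℓ^ε⌉ is greater than ε/192. -/

import Mathlib

open scoped MatrixGroups Matrix

/-- The dimension of the `(-1)`-eigenspace of a square matrix `M`, i.e. the dimension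
of the kernel of `M + I`. -/
noncomputable def negOneEigDim {m : Type*} [Fintype m] [DecidableEq m]
    (F : Type*) [Field F] (M : Matrix m m F) : ℕ :=
  Module.finrank F (LinearMap.ker (Matrix.toLin' (M + 1)))

namespace OrthCount

open Module

/-- The group of isometries of a bilinear form. -/
def Og {F V : Type*} [Field F] [AddCommGroup V] [Module F V] (B : LinearMap.BilinForm F V) :
    Subgroup (V ≃ₗ[F] V) where
  carrier := {g | ∀ x y, B (g x) (g y) = B x y}
  mul_mem' := by
    intro a b ha hb x y
    simp only [Set.mem_ofPred_eq] at ha hb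
    rw [LinearEquiv.mul_apply, LinearEquiv.mul_apply, ha, hb]
  one_mem' := by intro x y; rfl
  inv_mem' := by
    intro a ha x y
    simp only [Set.mem_ofPred_eq] at ha
    rw [← ha]
    congr 1
    · congr 1
      exact a.apply_symm_apply x
    · exact a.apply_symm_apply y

section Witt

variable {F V : Type*} [Field F] [AddCommGroup V] [Module F V] {B : LinearMap.BilinForm F V}

theorem exists_reflection (hB : B.IsSymm) (v : V) (hv : B v v ≠ 0) :
    ∃ g ∈ Og B, ∀ x, g x = x - (2 * B x v / B v v) • v := by
  let f : V →ₗ[F] V :=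
    { toFun := fun x => x - (2 * B x v / B v v) • v
      map_add' := by
        intro x y
        have : 2 * B (x + y) v / B v v = 2 * B x v / B v v + 2 * B y v / B v v := by
          simp only [map_add, LinearMap.add_apply]; ring
        rw [this, add_smul]; abel
      map_smul' := by
        intro c x
        have : 2 * B (c • x) v / B v v = c * (2 * B x v / B v v) := by
          simp only [map_smul, LinearMap.smul_apply, smul_eq_mul]; ring
        rw [this, mul_smul, RingHom.id_apply, smul_sub] }
  have hf : ∀ x, f x = x - (2 * B x v / B v v) • v := fun x => rfl
  have hinv : Function.Involutive f := by
    intro x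
    have : 2 * B (f x) v / B v v = - (2 * B x v / B v v) := by
      rw [hf]; simp only [map_sub, map_smul, LinearMap.sub_apply, LinearMap.smul_apply, smul_eq_mul]
      field_simp; ring
    rw [hf (f x), this, hf x]; simp
  refine ⟨LinearEquiv.ofInvolutive f hinv, ?_, fun x => rfl⟩
  intro x y
  change B (f x) (f y) = B x y
  rw [hf, hf]
  have h1 : B v y = B y v := hB.eq v y
  simp only [map_sub, map_smul, LinearMap.sub_apply, LinearMap.smul_apply, smul_eq_mul, h1]
  field_simp; ring

theorem exists_isometry_vec (h2 : (2 : F) ≠ 0) (hB : B.IsSymm) (x y : V) (hxy : B x x = B y y)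
    (hx : B x x ≠ 0) : ∃ g ∈ Og B, g x = y ∧ ∀ z, B z x = 0 → B z y = 0 → g z = z := by
  have hyx : B y x = B x y := hB.eq y x
  by_cases h : B (x - y) (x - y) = 0
  · have h' : B (x + y) (x + y) ≠ 0 := by
      intro h'
      simp only [map_sub, map_add, LinearMap.sub_apply, LinearMap.add_apply, hyx] at h h'
      have : (2 * 2) * B x x = 0 := by linear_combination h + h' + (2) * hxy
      simp_all
    obtain ⟨g, hg, hg'⟩ := exists_reflection hB _ h'
    obtain ⟨k, hk, hk'⟩ := exists_reflection hB y (hxy ▸ hx)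
    refine ⟨k * g, mul_mem hk hg, ?_, ?_⟩
    · have e : 2 * B x (x + y) / B (x + y) (x + y) = 1 := by
        rw [div_eq_one_iff_eq h']
        simp only [map_add, LinearMap.add_apply, hyx]
        linear_combination hxy
      rw [LinearEquiv.mul_apply, hg', e, hk']
      have e2 : 2 * B (x - (1 : F) • (x + y)) y / B y y = -2 := by
        have : B y y ≠ 0 := hxy ▸ hx
        simp only [one_smul, sub_add_cancel_left, map_neg, LinearMap.neg_apply]
        field_simp
      rw [e2]; module
    · intro z h1 h3
      have e : g z = z := by rw [hg']; simp [h1, h3]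
      rw [LinearEquiv.mul_apply, e, hk']; simp [h3]
  · obtain ⟨g, hg, hg'⟩ := exists_reflection hB _ h
    refine ⟨g, hg, ?_, ?_⟩
    · have e : 2 * B x (x - y) / B (x - y) (x - y) = 1 := by
        rw [div_eq_one_iff_eq h]
        simp only [map_sub, LinearMap.sub_apply, hyx]
        linear_combination hxy
      rw [hg', e]; module
    · intro z h1 h3
      rw [hg']; simp [h1, h3]

theorem witt_orth (h2 : (2 : F) ≠ 0) (hB : B.IsSymm) {ι : Type*} (u w : ι → V)
    (hu : ∀ i j, i ≠ j → B (u i) (u j) = 0) (hw : ∀ i j, i ≠ j → B (w i) (w j) = 0)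
    (huw : ∀ i, B (u i) (u i) = B (w i) (w i)) (hne : ∀ i, B (u i) (u i) ≠ 0) (s : Finset ι) :
    ∃ g ∈ Og B, ∀ i ∈ s, g (u i) = w i := by
  classical
  induction s using Finset.induction_on with
  | empty => exact ⟨1, one_mem _, by simp⟩
  | insert a s ha ih =>
    obtain ⟨g, hg, hgs⟩ := ih
    obtain ⟨k, hk, hk1, hk2⟩ := exists_isometry_vec h2 hB (g (u a)) (w a)
      (by rw [hg, huw]) (by rw [hg]; exact hne a)
    refine ⟨k * g, mul_mem hk hg, ?_⟩
    intro i hi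
    rw [LinearEquiv.mul_apply]
    rcases Finset.mem_insert.1 hi with rfl | hi
    · exact hk1
    · have hia : i ≠ a := fun h => ha (h ▸ hi)
      rw [hgs i hi]
      apply hk2
      · rw [← hgs i hi, hg, hu i a hia]
      · exact hw i a hia

theorem witt_nondeg {X : Type*} [AddCommGroup X] [Module F X] [FiniteDimensional F X]
    (h2 : (2 : F) ≠ 0) (hB : B.IsSymm) {C : LinearMap.BilinForm F X} (hC : C.IsSymm)
    (hC' : C.Nondegenerate) (θ η : X →ₗ[F] V) (hθ : ∀ x y, B (θ x) (θ y) = C x y)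
    (hη : ∀ x y, B (η x) (η y) = C x y) : ∃ g ∈ Og B, ∀ x, g (θ x) = η x := by
  let : Invertible (2 : F) := invertibleOfNonzero h2
  obtain ⟨v, hv⟩ := LinearMap.BilinForm.exists_orthogonal_basis (LinearMap.BilinForm.isSymm_iff.1 hC)
  have hv' : ∀ i j, i ≠ j → C (v i) (v j) = 0 := fun i j hij => hv hij
  have hvn : ∀ i, C (v i) (v i) ≠ 0 := by
    intro i hi
    apply v.ne_zero i
    apply hC'.1
    intro y
    have : C (v i) = 0 := by
      apply v.ext
      intro j
      by_cases h : i = j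
      · subst h; simpa using hi
      · simpa using hv' i j h
    rw [this]; rfl
  obtain ⟨g, hg, hgs⟩ := witt_orth h2 hB (fun i => θ (v i)) (fun i => η (v i))
    (by intro i j hij; rw [hθ]; exact hv' i j hij) (by intro i j hij; rw [hη]; exact hv' i j hij)
    (by intro i; rw [hθ, hη]) (by intro i; rw [hθ]; exact hvn i) Finset.univ
  refine ⟨g, hg, ?_⟩
  have : (g : V →ₗ[F] V) ∘ₗ θ = η := v.ext fun i => hgs i (Finset.mem_univ _)
  intro x
  exact LinearMap.congr_fun this x

/-- Hyperbolic partner of a totally isotropic embedding. -/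
theorem exists_partner {K : Type*} [AddCommGroup K] [Module F K] [FiniteDimensional F K]
    [FiniteDimensional F V]
    (h2 : (2 : F) ≠ 0) (hB : B.IsSymm) (hBn : B.Nondegenerate)
    {T : LinearMap.BilinForm F K} (hT : T.IsSymm) (hTn : T.Nondegenerate)
    (φ : K →ₗ[F] V) (hφ : Function.Injective φ) (hiso : ∀ x y, B (φ x) (φ y) = 0) :
    ∃ ψ : K →ₗ[F] V, (∀ x y, B (φ x) (ψ y) = T x y) ∧ ∀ x y, B (ψ x) (ψ y) = 0 := by
  obtain ⟨p, hp⟩ := φ.exists_leftInverse_of_injective (LinearMap.ker_eq_bot.2 hφ)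
  have hp' : ∀ x, p (φ x) = x := fun x => LinearMap.congr_fun hp x
  let ψ0 : K →ₗ[F] V :=
    (B.toDual hBn).symm.toLinearMap ∘ₗ (p.dualMap) ∘ₗ T
  have h0 : ∀ x y, B (ψ0 y) (φ x) = T y x := by
    intro x y
    have : B (ψ0 y) = (p.dualMap) (T y) := by
      have := (B.toDual hBn).apply_symm_apply (p.dualMap (T y))
      ext z
      rw [← this, LinearMap.BilinForm.toDual_def]
      rfl
    rw [this, LinearMap.dualMap_apply, hp']
  have h1 : ∀ x y, B (φ x) (ψ0 y) = T x y := by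
    intro x y
    rw [← hT.eq, ← hB.eq]; exact h0 x y
  let γ : K →ₗ[F] K := (T.toDual hTn).symm.toLinearMap ∘ₗ (ψ0.dualMap) ∘ₗ B ∘ₗ ψ0
  have hγ : ∀ x y, T (γ x) y = B (ψ0 x) (ψ0 y) := by
    intro x y
    have := (T.toDual hTn).apply_symm_apply (ψ0.dualMap (B (ψ0 x)))
    rw [← LinearMap.BilinForm.toDual_def (B := T) (hTn)]
    change (T.toDual hTn) ((T.toDual hTn).symm (ψ0.dualMap (B (ψ0 x)))) y = _
    rw [this]; rfl
  refine ⟨ψ0 - (1/2 : F) • (φ ∘ₗ γ), ?_, ?_⟩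
  · intro x y
    simp [h1, hiso]
  · intro x y
    simp only [LinearMap.sub_apply, LinearMap.smul_apply, LinearMap.comp_apply, map_sub, map_smul,
      h0, h1, hγ, hiso, smul_eq_mul]
    have : T x (γ y) = B (ψ0 x) (ψ0 y) := by
      rw [hT.eq, hγ]; exact hB.eq _ _
    rw [this]
    field_simp; ring

/-- Hyperbolic form on `K × K`. -/
def hyp {K : Type*} [AddCommGroup K] [Module F K] (T : LinearMap.BilinForm F K) :
    LinearMap.BilinForm F (K × K) :=
  LinearMap.mk₂ F (fun u v => T u.1 v.2 + T v.1 u.2)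
    (by intros; simp; ring) (by intros; simp; ring) (by intros; simp; ring) (by intros; simp; ring)

theorem hyp_apply {K : Type*} [AddCommGroup K] [Module F K] (T : LinearMap.BilinForm F K)
    (u v : K × K) : hyp T u v = T u.1 v.2 + T v.1 u.2 := rfl

theorem hyp_symm {K : Type*} [AddCommGroup K] [Module F K] (T : LinearMap.BilinForm F K) :
    (hyp T).IsSymm := ⟨by intro x y; simp [hyp_apply]; ring⟩

theorem hyp_nondeg {K : Type*} [AddCommGroup K] [Module F K] {T : LinearMap.BilinForm F K}
    (hT : T.IsSymm) (hTn : T.Nondegenerate) : (hyp T).Nondegenerate := by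
  have key : (hyp T).SeparatingLeft := by
    rintro ⟨x, y⟩ h
    have hx : x = 0 := by
      apply hTn.1; intro z
      simpa [hyp_apply] using h (0, z)
    have hy : y = 0 := by
      apply hTn.1; intro z
      have := h (z, 0)
      rw [← hT.eq]
      simpa [hyp_apply] using this
    rw [hx, hy]; rfl
  refine ⟨key, ?_⟩
  intro y h
  apply key
  intro x
  rw [← (hyp_symm T).eq]; exact h x

theorem transitive_iso {K : Type*} [AddCommGroup K] [Module F K] [FiniteDimensional F K]
    [FiniteDimensional F V]
    (h2 : (2 : F) ≠ 0) (hB : B.IsSymm) (hBn : B.Nondegenerate)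
    {T : LinearMap.BilinForm F K} (hT : T.IsSymm) (hTn : T.Nondegenerate)
    (φ φ' : K →ₗ[F] V) (hφ : Function.Injective φ) (hiso : ∀ x y, B (φ x) (φ y) = 0)
    (hφ' : Function.Injective φ') (hiso' : ∀ x y, B (φ' x) (φ' y) = 0) :
    ∃ g ∈ Og B, ∀ x, g (φ x) = φ' x := by
  obtain ⟨ψ, h1, h3⟩ := exists_partner h2 hB hBn hT hTn φ hφ hiso
  obtain ⟨ψ', h1', h3'⟩ := exists_partner h2 hB hBn hT hTn φ' hφ' hiso'
  obtain ⟨g, hg, hgx⟩ := witt_nondeg h2 hB (hyp_symm T) (hyp_nondeg hT hTn)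
    (φ.coprod ψ) (φ'.coprod ψ') 
    (by
      intro x y
      have : B (ψ x.2) (φ y.1) = T y.1 x.2 := by rw [← hB.eq]; exact h1 _ _
      simp [h1, h3, hiso, hyp_apply, this])
    (by
      intro x y
      have : B (ψ' x.2) (φ' y.1) = T y.1 x.2 := by rw [← hB.eq]; exact h1' _ _
      simp [h1', h3', hiso', hyp_apply, this])
  refine ⟨g, hg, fun x => ?_⟩
  simpa using hgx (x, 0)

end Witt

end OrthCount

namespace OrthCount

open Module Polynomial

/-- Arithmetic data: `2 ^ s` is (at least) the part of `q ^ (2 ^ b) - 1` that forces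
the exponent to be divisible by `2 ^ b`. -/
structure Arith (q b s : ℕ) : Prop where
  odd : Odd q
  two_le : 2 ≤ b
  dvd : 2 ^ s ∣ q ^ (2 ^ b) - 1
  ndvd : ¬ 2 ^ s ∣ q ^ (2 ^ (b - 1)) - 1

theorem Arith.exists {q b : ℕ} (hq : Odd q) (hq3 : 3 ≤ q) (hb : 2 ≤ b) : ∃ s, Arith q b s := by
  obtain ⟨c, rfl⟩ : ∃ c, b = c + 1 := ⟨b - 1, by omega⟩
  have e : q ^ (2 ^ (c + 1)) - 1 = (q ^ (2 ^ c) - 1) * (q ^ (2 ^ c) + 1) := by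
    rw [pow_succ, pow_mul]
    have := Nat.sq_sub_sq (q ^ 2 ^ c) 1
    rw [one_pow] at this
    rw [this, mul_comm]
  have hpos : q ^ (2 ^ c) - 1 ≠ 0 := by
    have : 1 < q ^ (2 ^ c) := Nat.one_lt_pow (by positivity) (by omega)
    omega
  obtain ⟨t, r, hr, hrt⟩ := Nat.exists_eq_two_pow_mul_odd hpos
  refine ⟨t + 1, hq, hb, ?_, ?_⟩
  · rw [e, pow_succ]
    apply mul_dvd_mul
    · rw [hrt]; exact dvd_mul_right _ _
    · exact (hq.pow.add_one).two_dvd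
  · rw [Nat.add_sub_cancel, hrt, pow_succ]
    intro h
    have := Nat.dvd_of_mul_dvd_mul_left (by positivity) h
    exact (Nat.not_even_iff_odd.2 hr) (even_iff_two_dvd.2 this)

theorem Arith.pow_dvd {q b s : ℕ} (h : Arith q b s) {d : ℕ} (hd : 2 ^ s ∣ q ^ d - 1) :
    2 ^ b ∣ d := by
  have h1 := Nat.dvd_gcd hd h.dvd
  rw [Nat.pow_sub_one_gcd_pow_sub_one] at h1
  obtain ⟨c, hc, hc'⟩ := (Nat.dvd_prime_pow Nat.prime_two).1 (Nat.gcd_dvd_right d (2 ^ b))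
  rcases hc.lt_or_eq with hlt | rfl
  · exfalso
    apply h.ndvd
    refine h1.trans ?_
    rw [hc']
    exact Nat.pow_sub_one_dvd_pow_sub_one q (pow_dvd_pow 2 (by omega))
  · rw [← hc']; exact Nat.gcd_dvd_left _ _

theorem Arith.two_le_s {q b s : ℕ} (h : Arith q b s) : 2 ≤ s := by
  by_contra hs
  apply h.ndvd
  have : s ≤ 1 := by omega
  refine (pow_dvd_pow 2 this).trans ?_
  rw [pow_one]
  have := h.odd.pow (n := 2 ^ (b - 1))
  exact (Nat.Odd.sub_odd this odd_one).two_dvd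

theorem Arith.not_dvd_add_one {q b s : ℕ} (h : Arith q b s) (i : ℕ) : ¬ 2 ^ s ∣ q ^ i + 1 := by
  intro hd
  have h1 : 2 ^ s ∣ q ^ (2 * i) - 1 := by
    have e : q ^ (2 * i) - 1 = (q ^ i + 1) * (q ^ i - 1) := by
      have := Nat.sq_sub_sq (q ^ i) 1
      rw [one_pow] at this
      rw [← this, mul_comm, pow_mul]
    rw [e]; exact dvd_mul_of_dvd_left hd _
  have h2 := h.pow_dvd h1
  have h3 : 2 * 2 ∣ 2 * i := (pow_dvd_pow 2 h.two_le).trans h2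
  have h4 : 2 ∣ i := Nat.dvd_of_mul_dvd_mul_left (by norm_num) h3
  obtain ⟨j, rfl⟩ := h4
  have h5 : 4 ∣ q ^ (2 * j) + 1 := by
    have : (2 : ℕ) ^ 2 ∣ _ := (pow_dvd_pow 2 h.two_le_s).trans hd
    simpa using this
  rw [mul_comm, pow_mul] at h5
  obtain ⟨k, hk⟩ := h.odd.pow (n := j)
  rw [hk] at h5
  ring_nf at h5
  omega

theorem two_pow_dvd_orderOf {M : Type*} [Monoid M] {x : M} {N s : ℕ}
    (hs : 2 ^ s ∣ N) (h1 : x ^ N = 1) (h2 : x ^ (N / 2) ≠ 1) : 2 ^ s ∣ orderOf x := by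
  obtain ⟨c, hc⟩ := orderOf_dvd_of_pow_eq_one h1
  have hodd : Odd c := by
    by_contra h
    rw [Nat.not_odd_iff_even] at h
    obtain ⟨e, rfl⟩ := h
    apply h2
    apply orderOf_dvd_iff_pow_eq_one.1
    rw [hc, ← two_mul, mul_left_comm, Nat.mul_div_cancel_left _ (by norm_num)]
    exact dvd_mul_right _ _
  rw [hc] at hs
  refine Nat.Coprime.dvd_of_dvd_mul_right ?_ hs
  exact Nat.Coprime.pow_left _ ((Nat.coprime_two_left).2 hodd)

section

variable {F V : Type*} [Field F] [AddCommGroup V] [Module F V] {B : LinearMap.BilinForm F V}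

instance Og_finite [Finite V] (B : LinearMap.BilinForm F V) : Finite (Og B) :=
  Finite.of_injective (fun g : Og B => ((g : V ≃ₗ[F] V) : V → V))
    (fun _ _ h => Subtype.ext (DFunLike.coe_injective h))

instance lin_finite {K : Type*} [AddCommGroup K] [Module F K] [Finite K] [Finite V] :
    Finite (K →ₗ[F] V) :=
  Finite.of_injective (fun g : K →ₗ[F] V => (g : K → V)) DFunLike.coe_injective

variable {K : Type*} [Field K] [Algebra F K]

theorem conj_ne [Finite F] [Finite K] {q b s : ℕ} (hq : q = Nat.card F) (h : Arith q b s) (l : K)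
    (hl0 : l ≠ 0)
    (hl : 2 ^ s ∣ orderOf l) (σ : K ≃ₐ[F] K) : σ l ≠ l⁻¹ := by
  intro hσ
  obtain ⟨p, hp⟩ := CharP.exists F
  have : Fact p.Prime := ⟨CharP.char_is_prime F p⟩
  obtain ⟨i, hi⟩ := FiniteField.exists_forall_apply_eq_pow F p K σ
  rw [hi] at hσ
  have : l ^ (Nat.card F ^ i + 1) = 1 := by
    rw [pow_succ, hσ, inv_mul_cancel₀ hl0]
  rw [← hq] at this
  exact h.not_dvd_add_one i (hl.trans (orderOf_dvd_of_pow_eq_one this))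

/-- A map from `K` intertwining `l` with an isometry is totally isotropic
when `l` is not conjugate to its inverse. -/
theorem iso_of_conj_ne [FiniteDimensional F K] [IsGalois F K] (l : K) (hl0 : l ≠ 0)
    (hl : ∀ σ : K ≃ₐ[F] K, σ l ≠ l⁻¹) (g : Og B)
    (φ : K →ₗ[F] V) (hφ : ∀ x, (g : V ≃ₗ[F] V) (φ x) = φ (l * x)) (x y : K) :
    B (φ x) (φ y) = 0 := by
  have hne : aeval l⁻¹ (minpoly F l) ≠ 0 := by
    intro h
    have hl' : IsIntegral F l := Algebra.IsIntegral.isIntegral l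
    have e := minpoly.eq_of_irreducible_of_monic (minpoly.irreducible hl') h (minpoly.monic hl')
    have hc : IsConjRoot F l⁻¹ l := by rw [isConjRoot_def, ← e]
    obtain ⟨σ, hσ⟩ := isConjRoot_iff_exists_algEquiv.1 hc
    exact hl σ hσ
  have h1 : ∀ x y, B (φ (l * x)) (φ y) = B (φ x) (φ (l⁻¹ * y)) := by
    intro x y
    have := g.2 (φ x) (φ (l⁻¹ * y))
    rw [← this, hφ, hφ, mul_inv_cancel_left₀ hl0]
  have h2 : ∀ (p : F[X]) x y, B (φ (aeval l p * x)) (φ y) = B (φ x) (φ (aeval l⁻¹ p * y)) := by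
    intro p
    induction p using Polynomial.induction_on' with
    | add p r hp hr =>
      intro x y
      simp only [map_add, add_mul, LinearMap.add_apply, hp, hr]
    | monomial n a =>
      have hn : ∀ x y, B (φ (l ^ n * x)) (φ y) = B (φ x) (φ (l⁻¹ ^ n * y)) := by
        induction n with
        | zero => simp
        | succ n ih =>
          intro x y
          rw [pow_succ, mul_assoc, ih, h1, pow_succ', mul_assoc]
      intro x y
      rw [aeval_monomial, aeval_monomial, mul_assoc, mul_assoc, ← Algebra.smul_def,
        ← Algebra.smul_def, map_smul, map_smul, map_smul, map_smul, LinearMap.smul_apply, hn]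
  have h3 := h2 (minpoly F l) x ((aeval l⁻¹ (minpoly F l))⁻¹ * y)
  rw [mul_inv_cancel_left₀ hne, minpoly.aeval] at h3
  rw [← h3]; simp

/-- Eigen-embedding. -/
theorem exists_embed (l : K) (f : F[X]) (hsurj : ∀ z : K, ∃ p : F[X], aeval l p = z)
    (hker : ∀ p : F[X], aeval l p = 0 → f ∣ p) (a : V →ₗ[F] V) (v : V) (hv : v ≠ 0)
    (hf : aeval a f v = 0) :
    ∃ φ : K →ₗ[F] V, Function.Injective φ ∧ ∀ x, a (φ x) = φ (l * x) := by
  let ev : F[X] →ₗ[F] V := (LinearMap.applyₗ v) ∘ₗ (aeval (R := F) a).toLinearMap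
  have hev : ∀ p, ev p = aeval a p v := fun p => rfl
  obtain ⟨r, hr⟩ := (aeval (R := F) l).toLinearMap.exists_rightInverse_of_surjective
    (LinearMap.range_eq_top.2 hsurj)
  have hr' : ∀ z, aeval l (r z) = z := fun z => LinearMap.congr_fun hr z
  have key : ∀ p, ev (r (aeval l p)) = ev p := by
    intro p
    obtain ⟨c, hc⟩ := hker (r (aeval l p) - p) (by rw [map_sub, hr', sub_self])
    rw [← sub_eq_zero, ← map_sub, hc, hev, mul_comm, map_mul, Module.End.mul_apply, hf, map_zero]
  have hact : ∀ x, a (ev (r x)) = ev (r (l * x)) := by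
    intro x
    have : ev (r (l * x)) = ev (X * r x) := by
      rw [← key (X * r x), map_mul (aeval l), aeval_X, hr']
    rw [this, hev, hev, map_mul, aeval_X, Module.End.mul_apply]
  have hactp : ∀ (p : F[X]) x, aeval a p (ev (r x)) = ev (r (aeval l p * x)) := by
    intro p x
    have : ev (r (aeval l p * x)) = ev (p * r x) := by
      rw [← key (p * r x), map_mul (aeval l), hr']
    rw [this, hev, hev, map_mul, Module.End.mul_apply]
  refine ⟨ev ∘ₗ r, ?_, hact⟩
  rw [← LinearMap.ker_eq_bot, LinearMap.ker_eq_bot']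
  intro z hz
  by_contra hz0
  obtain ⟨p, hp⟩ := hsurj z⁻¹
  have h1 := hactp p z
  rw [hp, inv_mul_cancel₀ hz0] at h1
  have h3 : ev (r z) = 0 := hz
  rw [h3, map_zero] at h1
  have h2 := key 1
  rw [map_one, ← h1] at h2
  apply hv
  rw [hev, map_one] at h2
  exact h2.symm

theorem exists_irred_factor (a : V →ₗ[F] V) (p : F[X]) (hp0 : p ≠ 0) :
    (∃ w, w ≠ 0 ∧ aeval a p w = 0) →
    ∃ f, Irreducible f ∧ f ∣ p ∧ ∃ v, v ≠ 0 ∧ aeval a f v = 0 := by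
  induction p using UniqueFactorizationMonoid.induction_on_prime with
  | h₁ => exact absurd rfl hp0
  | h₂ u hu =>
    rintro ⟨w, hw, hw'⟩
    obtain ⟨c, hc, rfl⟩ := Polynomial.isUnit_iff.1 hu
    exfalso
    rw [aeval_C, Module.algebraMap_end_apply] at hw'
    rcases smul_eq_zero.1 hw' with h | h
    · exact hc.ne_zero h
    · exact hw h
  | h₃ r f hr hf ih =>
    rintro ⟨w, hw, hw'⟩
    rw [mul_comm, map_mul, Module.End.mul_apply] at hw'
    by_cases h : aeval a f w = 0
    · exact ⟨f, hf.irreducible, dvd_mul_right _ _, w, hw, h⟩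
    · obtain ⟨f', h1, h2, h3⟩ := ih hr ⟨_, h, hw'⟩
      exact ⟨f', h1, h2.mul_left _, h3⟩

/-- Totally isotropic embeddings of `K`. -/
def IsoEmb (B : LinearMap.BilinForm F V) (φ : K →ₗ[F] V) : Prop :=
  Function.Injective φ ∧ ∀ x y, B (φ x) (φ y) = 0

/-- The witness for bad elements. -/
def BadIn (K : Type*) [Field K] [Algebra F K] (B : LinearMap.BilinForm F V) (g : Og B) : Prop :=
  ∃ l : K, l ≠ 0 ∧ (∀ σ : K ≃ₐ[F] K, σ l ≠ l⁻¹) ∧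
    (∃ φ : K →ₗ[F] V, IsoEmb B φ ∧ ∀ x, (g : V ≃ₗ[F] V) (φ x) = φ (l * x)) ∧
    (∃ φ : K →ₗ[F] V, IsoEmb B φ ∧ ∀ x, (g : V ≃ₗ[F] V) (φ x) = φ (l⁻¹ * x))

theorem aeval_adjoint (g : Og B) (p : F[X]) (x y : V) :
    B (aeval ((g : V ≃ₗ[F] V) : V →ₗ[F] V) p x) y =
      B x (aeval (((g⁻¹ : Og B) : V ≃ₗ[F] V) : V →ₗ[F] V) p y) := by
  have h1 : ∀ x y, B ((g : V ≃ₗ[F] V) x) y = B x (((g⁻¹ : Og B) : V ≃ₗ[F] V) y) := by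
    intro x y
    rw [← g.2 x]
    congr 1
    exact ((g : V ≃ₗ[F] V).apply_symm_apply y).symm
  induction p using Polynomial.induction_on' generalizing x y with
  | add p r hp hr => simp only [map_add, LinearMap.add_apply, hp, hr]
  | monomial n a =>
    have hn : ∀ x y, B ((((g : V ≃ₗ[F] V) : V →ₗ[F] V) ^ n) x) y =
        B x ((((((g⁻¹ : Og B) : V ≃ₗ[F] V) : V →ₗ[F] V)) ^ n) y) := by
      induction n with
      | zero => simp
      | succ n ih =>
        intro x y
        rw [pow_succ, Module.End.mul_apply, ih, pow_succ', Module.End.mul_apply]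
        exact h1 _ _
    rw [aeval_monomial, aeval_monomial, Module.End.mul_apply, Module.End.mul_apply,
      Module.algebraMap_end_apply, Module.algebraMap_end_apply, map_smul, map_smul,
      LinearMap.smul_apply, hn]

theorem bad_core [Finite F] [FiniteDimensional F V] (h2 : (2 : F) ≠ 0) (hB : B.IsSymm)
    (hBn : B.Nondegenerate) {q b s : ℕ} (hq : q = Nat.card F) (h : Arith q b s)
    (g : Og B) (N : ℕ) (hN2 : 2 ^ s ∣ 2 * N) (f : F[X]) (hf : Irreducible f)
    (hfd : f ∣ X ^ N + 1) (v : V) (hv : v ≠ 0)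
    (hfv : aeval ((g : V ≃ₗ[F] V) : V →ₗ[F] V) f v = 0)
    [FiniteDimensional F K] (hK : finrank F K = f.natDegree) :
    BadIn K B g ∧ 2 ^ b ∣ f.natDegree ∧ 2 * f.natDegree ≤ finrank F V := by
  have hfin : Finite K := Module.finite_of_finite F
  have hfact : Fact (Irreducible f) := ⟨hf⟩
  have hfin2 : FiniteDimensional F (AdjoinRoot f) := (AdjoinRoot.powerBasis hf.ne_zero).finite
  have hfin3 : Finite (AdjoinRoot f) := Module.finite_of_finite F
  have hdim : finrank F (AdjoinRoot f) = f.natDegree := by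
    rw [(AdjoinRoot.powerBasis hf.ne_zero).finrank, AdjoinRoot.powerBasis_dim]
  obtain ⟨e⟩ := FiniteField.nonempty_algHom_of_finrank_dvd (F := F) (K := AdjoinRoot f) (L := K)
    (by rw [hdim, hK])
  have hebij : Function.Surjective e := by
    have : Function.Injective e.toLinearMap := e.toRingHom.injective
    exact (LinearMap.injective_iff_surjective_of_finrank_eq_finrank (by rw [hdim, hK])).1 this
  let l : K := e (AdjoinRoot.root f)
  have hmk : ∀ p : F[X], aeval l p = e (AdjoinRoot.mk f p) := by
    intro p
    rw [← AdjoinRoot.aeval_eq, ← aeval_algHom_apply]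
  have hsurj : ∀ z : K, ∃ p : F[X], aeval l p = z := by
    intro z
    obtain ⟨y, rfl⟩ := hebij z
    obtain ⟨p, rfl⟩ := AdjoinRoot.mk_surjective y
    exact ⟨p, hmk p⟩
  have hker : ∀ p : F[X], aeval l p = 0 → f ∣ p := by
    intro p hp
    rw [hmk, map_eq_zero_iff e e.toRingHom.injective] at hp
    exact AdjoinRoot.mk_eq_zero.1 hp
  have hlf : aeval l f = 0 := by rw [hmk, AdjoinRoot.mk_self, map_zero]
  have h2K : (2 : K) ≠ 0 := by
    have := (map_ne_zero (algebraMap F K)).2 h2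
    rwa [map_ofNat] at this
  have hlN : l ^ N = -1 := by
    obtain ⟨c, hc⟩ := hfd
    have := congrArg (aeval l) hc
    rw [map_mul, hlf, zero_mul] at this
    simp only [map_add, map_pow, aeval_X, map_one] at this
    exact eq_neg_of_add_eq_zero_left this
  have hN0 : N ≠ 0 := by
    rintro rfl
    rw [pow_zero] at hlN
    apply h2K
    linear_combination hlN
  have hl0 : l ≠ 0 := by
    intro h0
    rw [h0, zero_pow hN0] at hlN
    simp at hlN
  have hord : 2 ^ s ∣ orderOf l := by
    apply two_pow_dvd_orderOf hN2
    · rw [mul_comm, pow_mul, hlN]; norm_num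
    · rw [Nat.mul_div_cancel_left _ (by norm_num), hlN]
      intro h
      apply h2K
      linear_combination -h
  have hdvd : 2 ^ b ∣ f.natDegree := by
    apply h.pow_dvd
    refine hord.trans (orderOf_dvd_of_pow_eq_one ?_)
    have := Fintype.ofFinite K
    have hc : q ^ f.natDegree = Fintype.card K := by
      rw [hq, ← hK, ← Nat.card_eq_fintype_card, Module.natCard_eq_pow_finrank (K := F) (V := K)]
    rw [hc]
    exact FiniteField.pow_card_sub_one_eq_one l hl0
  have hcj := conj_ne hq h l hl0 hord
  have hcj' : ∀ σ : K ≃ₐ[F] K, σ l⁻¹ ≠ l⁻¹⁻¹ := by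
    intro σ hσ
    rw [map_inv₀, inv_inj] at hσ
    exact hcj σ hσ
  obtain ⟨φ, hφ1, hφ2⟩ := exists_embed l f hsurj hker _ v hv hfv
  have hφ3 := iso_of_conj_ne l hl0 hcj g φ hφ2
  obtain ⟨v', hv', hfv'⟩ :
      ∃ v', v' ≠ 0 ∧ aeval (((g⁻¹ : Og B) : V ≃ₗ[F] V) : V →ₗ[F] V) f v' = 0 := by
    by_contra hcon
    have hinj : Function.Injective (aeval (((g⁻¹ : Og B) : V ≃ₗ[F] V) : V →ₗ[F] V) f) := by
      rw [← LinearMap.ker_eq_bot, LinearMap.ker_eq_bot']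
      intro w hw
      by_contra hw0
      exact hcon ⟨w, hw0, hw⟩
    have hsur := LinearMap.surjective_of_injective hinj
    apply hv
    apply hBn.1
    intro y
    obtain ⟨z, rfl⟩ := hsur y
    rw [← aeval_adjoint, hfv, map_zero, LinearMap.zero_apply]
  obtain ⟨φ', hφ1', hphi2b⟩ := exists_embed l f hsurj hker _ v' hv' hfv'
  have hφ2' : ∀ x, (g : V ≃ₗ[F] V) (φ' x) = φ' (l⁻¹ * x) := by
    intro x
    have := hphi2b (l⁻¹ * x)
    rw [mul_inv_cancel_left₀ hl0] at this
    rw [← this]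
    exact (g : V ≃ₗ[F] V).apply_symm_apply _
  have hφ3' := iso_of_conj_ne l⁻¹ (inv_ne_zero hl0) hcj' g φ' hφ2'
  refine ⟨⟨l, hl0, hcj, ⟨φ, ⟨hφ1, hφ3⟩, hφ2⟩, ⟨φ', ⟨hφ1', hφ3'⟩, hφ2'⟩⟩, hdvd, ?_⟩
  have hT := traceForm_nondegenerate F K
  have hTs : (Algebra.traceForm F K).IsSymm := Algebra.traceForm_isSymm F
  obtain ⟨ψ, hψ1, hψ2⟩ := exists_partner h2 hB hBn hTs hT φ hφ1 hφ3
  have hinj : Function.Injective (φ.coprod ψ) := by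
    rw [← LinearMap.ker_eq_bot, LinearMap.ker_eq_bot']
    rintro ⟨x, y⟩ hxy
    simp only [LinearMap.coprod_apply] at hxy
    have hy : y = 0 := by
      apply hT.1; intro z
      rw [hTs.eq, ← hψ1, ← add_zero (B (φ z) (ψ y)), ← hφ3 z x, ← map_add, add_comm, hxy, map_zero, hφ3]
    have hx : x = 0 := by
      rw [hy, map_zero, add_zero] at hxy
      exact hφ1 (by rw [hxy, map_zero])
    rw [hx, hy]; rfl
  have := LinearMap.finrank_le_finrank_of_injective hinj
  rw [Module.finrank_prod, hK] at this
  omega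

theorem exists_bad [Finite F] [FiniteDimensional F V] (h2 : (2 : F) ≠ 0) (hB : B.IsSymm)
    (hBn : B.Nondegenerate) {q b s : ℕ} (hq : q = Nat.card F) (h : Arith q b s)
    (g : Og B) (hg : 2 ^ s ∣ orderOf g) :
    ∃ d, 0 < d ∧ 2 ^ b ∣ d ∧ 2 * d ≤ finrank F V ∧
      ∀ (K : Type) [Field K] [Algebra F K] [FiniteDimensional F K], finrank F K = d →
        BadIn K B g := by
  have : Finite V := Module.finite_of_finite F
  have h2d : 2 ∣ orderOf g :=
    (dvd_pow_self 2 (by have := h.two_le_s; omega)).trans hg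
  obtain ⟨N, hN⟩ := h2d
  have hpos := orderOf_pos g
  have hNpos : 0 < N := by omega
  set a : V →ₗ[F] V := ((g : V ≃ₗ[F] V) : V →ₗ[F] V) with ha
  have hpow : ∀ (n : ℕ) (x : V), (a ^ n) x = ((g ^ n : Og B) : V ≃ₗ[F] V) x := by
    intro n
    induction n with
    | zero => intro x; simp
    | succ n ih =>
      intro x
      rw [pow_succ, Module.End.mul_apply, ih, pow_succ]
      rfl
  have hne : g ^ N ≠ 1 := by
    intro h1
    have := orderOf_le_of_pow_eq_one hNpos h1
    omega
  obtain ⟨w, hw⟩ : ∃ w, ((g ^ N : Og B) : V ≃ₗ[F] V) w ≠ w := by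
    by_contra hcon
    push Not at hcon
    apply hne
    apply Subtype.ext
    ext x
    exact hcon x
  have hp0 : (X ^ N + 1 : F[X]) ≠ 0 := (monic_X_pow_add_C 1 hNpos.ne').ne_zero
  have hker : ∃ w, w ≠ 0 ∧ aeval a (X ^ N + 1 : F[X]) w = 0 := by
    refine ⟨(a ^ N) w - w, ?_, ?_⟩
    · rw [hpow]; exact sub_ne_zero.2 hw
    · simp only [map_add, map_pow, aeval_X, map_one, LinearMap.add_apply, Module.End.one_apply]
      have : (a ^ N) ((a ^ N) w) = w := by
        rw [← Module.End.mul_apply, ← pow_add, ← two_mul, ← hN, hpow, pow_orderOf_eq_one]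
        rfl
      rw [map_sub, this]; abel
  obtain ⟨f, hf, hfd, v, hv, hfv⟩ := exists_irred_factor a _ hp0 hker
  have hfact : Fact (Irreducible f) := ⟨hf⟩
  have hfin2 : FiniteDimensional F (AdjoinRoot f) := (AdjoinRoot.powerBasis hf.ne_zero).finite
  have hdim : finrank F (AdjoinRoot f) = f.natDegree := by
    rw [(AdjoinRoot.powerBasis hf.ne_zero).finrank, AdjoinRoot.powerBasis_dim]
  rw [hN] at hg
  obtain ⟨-, h1, h3⟩ := bad_core h2 hB hBn hq h g N hg f hf hfd v hv hfv hdim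
  exact ⟨f.natDegree, hf.natDegree_pos, h1, h3, fun K _ _ _ hK =>
    (bad_core h2 hB hBn hq h g N hg f hf hfd v hv hfv hK).1⟩

end

end OrthCount

namespace OrthCount

open Module Polynomial

section

variable {F V : Type*} [Field F] [AddCommGroup V] [Module F V] {B : LinearMap.BilinForm F V}
variable {K : Type*} [Field K] [Algebra F K]

theorem IsoEmb.comp_equiv {φ : K →ₗ[F] V} (h : IsoEmb B φ) (e : K ≃ₗ[F] K) :
    IsoEmb B (φ ∘ₗ (e : K →ₗ[F] K)) :=
  ⟨h.1.comp e.injective, fun x y => h.2 (e x) (e y)⟩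

/-- Multiplication by a nonzero element as a linear equivalence. -/
noncomputable def mulEquiv (F : Type*) {K : Type*} [Field F] [Field K] [Algebra F K] (c : Kˣ) :
    K ≃ₗ[F] K :=
  { LinearMap.mulLeft F (c : K) with
    invFun := fun x => (c : K)⁻¹ * x
    left_inv := fun x => by simp
    right_inv := fun x => by simp }

@[simp] theorem mulEquiv_apply (c : Kˣ) (x : K) : mulEquiv F c x = c * x := rfl

theorem card_pairs_le [Finite F] [FiniteDimensional F V] [FiniteDimensional F K]
    (h2 : (2 : F) ≠ 0) (hB : B.IsSymm) (hBn : B.Nondegenerate) (l : Kˣ) :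
    Nat.card {p : Og B × (K →ₗ[F] V) // IsoEmb B p.2 ∧
      ∀ x, (p.1 : V ≃ₗ[F] V) (p.2 x) = p.2 (l * x)} ≤ Nat.card (Og B) := by
  have : Finite V := Module.finite_of_finite F
  have hT := traceForm_nondegenerate F K
  have hTs : (Algebra.traceForm F K).IsSymm := Algebra.traceForm_isSymm F
  have tr : ∀ φ φ' : K →ₗ[F] V, IsoEmb B φ → IsoEmb B φ' →
      ∃ g : Og B, ∀ x, (g : V ≃ₗ[F] V) (φ x) = φ' x := by
    intro φ φ' h h'
    obtain ⟨g, hg, hg'⟩ := transitive_iso h2 hB hBn hTs hT φ φ' h.1 h.2 h'.1 h'.2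
    exact ⟨⟨g, hg⟩, hg'⟩
  by_cases hex : ∃ φ : K →ₗ[F] V, IsoEmb B φ
  swap
  · have : IsEmpty {p : Og B × (K →ₗ[F] V) // IsoEmb B p.2 ∧
      ∀ x, (p.1 : V ≃ₗ[F] V) (p.2 x) = p.2 (l * x)} := ⟨fun p => hex ⟨_, p.2.1⟩⟩
    simp
  obtain ⟨φ0, h0⟩ := hex
  choose y hy using fun φ : {φ : K →ₗ[F] V // IsoEmb B φ} => tr φ0 φ.1 h0 φ.2
  choose c hc using fun φ : {φ : K →ₗ[F] V // IsoEmb B φ} =>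
    tr φ.1 (φ.1 ∘ₗ (mulEquiv F l : K →ₗ[F] K)) φ.2 (φ.2.comp_equiv _)
  let Φ : {p : Og B × (K →ₗ[F] V) // IsoEmb B p.2 ∧
      ∀ x, (p.1 : V ≃ₗ[F] V) (p.2 x) = p.2 (l * x)} → Og B :=
    fun p => (c ⟨p.1.2, p.2.1⟩)⁻¹ * p.1.1 * y ⟨p.1.2, p.2.1⟩
  refine Nat.card_le_card_of_injective Φ ?_
  have hΦ : ∀ p x, (Φ p : V ≃ₗ[F] V) (φ0 x) = p.1.2 x := by
    intro p x
    change ((c ⟨p.1.2, p.2.1⟩ : Og B) : V ≃ₗ[F] V).symm ((p.1.1 : V ≃ₗ[F] V)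
      ((y ⟨p.1.2, p.2.1⟩ : V ≃ₗ[F] V) (φ0 x))) = _
    rw [hy, LinearEquiv.symm_apply_eq, hc, p.2.2]
    rfl
  rintro ⟨⟨g, φ⟩, hp⟩ ⟨⟨g', φ'⟩, hp'⟩ heq
  have e : φ = φ' := by
    ext x
    rw [← hΦ ⟨⟨g, φ⟩, hp⟩, ← hΦ ⟨⟨g', φ'⟩, hp'⟩, heq]
  subst e
  have : g = g' := by simpa [Φ] using heq
  subst this
  rfl

theorem card_badIn [Finite F] [FiniteDimensional F V] [FiniteDimensional F K]
    (h2 : (2 : F) ≠ 0) (hB : B.IsSymm) (hBn : B.Nondegenerate) :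
    Nat.card {g : Og B // BadIn K B g} * (2 * finrank F K) ≤ Nat.card (Og B) := by
  have : Finite V := Module.finite_of_finite F
  have : Finite K := Module.finite_of_finite F
  let P : Kˣ → Type _ := fun l => {p : Og B × (K →ₗ[F] V) // IsoEmb B p.2 ∧
      ∀ x, (p.1 : V ≃ₗ[F] V) (p.2 x) = p.2 (l * x)}
  have hP : Nat.card (Σ l, P l) ≤ Nat.card Kˣ * Nat.card (Og B) := by
    have := Fintype.ofFinite Kˣ
    rw [Nat.card_sigma]
    refine (Finset.sum_le_card_nsmul _ _ _ (fun l _ => card_pairs_le h2 hB hBn l)).trans ?_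
    rw [Finset.card_univ, ← Nat.card_eq_fintype_card, smul_eq_mul]
  choose l hl0 hconj hφ hψ using fun g : {g : Og B // BadIn K B g} => g.2
  choose φ hφ1 hφ2 using hφ
  choose ψ hψ1 hψ2 using hψ
  let tw : (K ≃ₐ[F] K) → Kˣ → (K ≃ₗ[F] K) := fun σ c => σ.toLinearEquiv.trans (mulEquiv F c)
  have htw : ∀ σ c x, tw σ c x = c * σ x := fun _ _ _ => rfl
  let lu : {g : Og B // BadIn K B g} → Kˣ := fun g => Units.mk0 (l g) (hl0 g)
  let bas : {g : Og B // BadIn K B g} → Bool → Kˣ := fun g t => if t then lu g else (lu g)⁻¹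
  let emb : {g : Og B // BadIn K B g} → Bool → (K →ₗ[F] V) := fun g t => if t then φ g else ψ g
  have hemb : ∀ g t, IsoEmb B (emb g t) := by
    intro g t
    cases t
    · exact hψ1 g
    · exact hφ1 g
  have hemb2 : ∀ g t x, (g.1 : V ≃ₗ[F] V) (emb g t x) = emb g t (bas g t * x) := by
    intro g t
    cases t
    · simpa [emb, bas, lu] using hψ2 g
    · simpa [emb, bas, lu] using hφ2 g
  let sg : (K ≃ₐ[F] K) → Kˣ → Kˣ := fun σ u => Units.map (σ.symm : K →* K) u
  let Ψ : {g : Og B // BadIn K B g} × (Bool × ((K ≃ₐ[F] K) × Kˣ)) → Σ l, P l :=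
    fun z => ⟨sg z.2.2.1 (bas z.1 z.2.1),
      ⟨⟨z.1.1, emb z.1 z.2.1 ∘ₗ (tw z.2.2.1 z.2.2.2 : K →ₗ[F] K)⟩,
        (hemb z.1 z.2.1).comp_equiv _, by
          intro x
          simp only [LinearMap.comp_apply, LinearEquiv.coe_coe, htw]
          rw [hemb2, map_mul z.2.2.1]
          congr 1
          have : (z.2.2.1) ((sg z.2.2.1 (bas z.1 z.2.1) : Kˣ) : K) = bas z.1 z.2.1 := by
            simp [sg]
          rw [this]; ring⟩⟩
  have hΨ : Function.Injective Ψ := by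
    rintro ⟨g, t, σ, c⟩ ⟨g', t', σ', c'⟩ heq
    have h1 : sg σ (bas g t) = sg σ' (bas g' t') := congrArg Sigma.fst heq
    have h3 : ∀ z z' : Σ l, P l, z = z' → z.2.1 = z'.2.1 := by rintro _ _ rfl; rfl
    have h4 := h3 _ _ heq
    have hg : g = g' := Subtype.ext (congrArg Prod.fst h4)
    subst hg
    have hmap : emb g t ∘ₗ (tw σ c : K →ₗ[F] K) = emb g t' ∘ₗ (tw σ' c' : K →ₗ[F] K) :=
      congrArg Prod.snd h4
    have key : ∀ σ σ' : K ≃ₐ[F] K, sg σ (lu g) ≠ sg σ' (lu g)⁻¹ := by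
      intro σ σ' h
      have h5 := congrArg (Units.val) h
      simp only [sg, Units.coe_map, MonoidHom.coe_coe, lu, Units.val_mk0, Units.val_inv_eq_inv_val]
        at h5
      apply hconj g (σ.symm.trans σ')
      change σ' (σ.symm (l g)) = _
      rw [h5]
      exact σ'.apply_symm_apply _
    have ht : t = t' := by
      cases t <;> cases t'
      · rfl
      · exact absurd h1.symm (by simpa [bas] using key σ' σ)
      · exact absurd h1 (by simpa [bas] using key σ σ')
      · rfl
    subst ht
    have hx : ∀ x, (c : K) * σ x = c' * σ' x := by
      intro x
      exact (hemb g t).1 (LinearMap.congr_fun hmap x)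
    have hc : c = c' := by
      have := hx 1
      rw [map_one, map_one, mul_one, mul_one] at this
      exact Units.ext this
    subst hc
    have hσ : σ = σ' := by
      ext x
      exact mul_left_cancel₀ c.ne_zero (hx x)
    subst hσ
    rfl
  have hle := (Nat.card_le_card_of_injective Ψ hΨ).trans hP
  have hg : Nat.card (K ≃ₐ[F] K) = finrank F K := IsGalois.card_aut_eq_finrank F K
  rw [Nat.card_prod, Nat.card_prod, Nat.card_prod, hg, Nat.card_eq_fintype_card (α := Bool),
    Fintype.card_bool] at hle
  have hpos : 0 < Nat.card Kˣ := Nat.card_pos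
  refine Nat.le_of_mul_le_mul_left (le_trans (le_of_eq ?_) hle) hpos
  ring

theorem card_bad_le [Finite F] [FiniteDimensional F V]
    (h2 : (2 : F) ≠ 0) (hB : B.IsSymm) (hBn : B.Nondegenerate) {q b s : ℕ}
    (hq : q = Nat.card F) (h : Arith q b s) {m : ℕ} (hm : finrank F V ≤ 2 * m + 1)
    (hmb : Real.log m + 1 ≤ 2 ^ b) :
    (Nat.card {g : Og B // 2 ^ s ∣ orderOf g} : ℝ) ≤ (Nat.card (Og B) : ℝ) / 2 := by
  classical
  have : Finite V := Module.finite_of_finite F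
  have := Fintype.ofFinite (Og B)
  obtain ⟨p, hp⟩ := CharP.exists F
  have : Fact p.Prime := ⟨CharP.char_is_prime F p⟩
  have hnz : ∀ j, NeZero (2 ^ b * (j + 1)) := fun j => ⟨by positivity⟩
  let E : ℕ → Finset (Og B) := fun j =>
    Finset.univ.filter (fun g => BadIn (FiniteField.Extension F p (2 ^ b * (j + 1))) B g)
  let bad : Finset (Og B) := Finset.univ.filter (fun g => 2 ^ s ∣ orderOf g)
  let N := m / 2 ^ b
  have hsub : bad ⊆ (Finset.range N).biUnion (fun j => E j) := by
    intro g hg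
    obtain ⟨d, hd, ⟨j, hj⟩, hdV, hK⟩ := exists_bad h2 hB hBn hq h g (Finset.mem_filter.1 hg).2
    have hj0 : 0 < j := by
      rcases Nat.eq_zero_or_pos j with rfl | h
      · simp at hj; omega
      · exact h
    refine Finset.mem_biUnion.2 ⟨j - 1, ?_, ?_⟩
    · rw [Finset.mem_range]
      have : j ≤ N := by
        rw [Nat.le_div_iff_mul_le (by positivity), mul_comm, ← hj]; omega
      omega
    · have e : j - 1 + 1 = j := by omega
      refine Finset.mem_filter.2 ⟨Finset.mem_univ _, ?_⟩
      apply hK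
      rw [hj, FiniteField.finrank_extension F p (2 ^ b * (j - 1 + 1)), e]
  have hE : ∀ j, ((E j).card : ℝ) ≤
      (Nat.card (Og B) : ℝ) / (2 * 2 ^ b) * ((j + 1 : ℕ) : ℝ)⁻¹ := by
    intro j
    have h1 := card_badIn (K := FiniteField.Extension F p (2 ^ b * (j + 1))) h2 hB hBn
    rw [FiniteField.finrank_extension, Nat.card_eq_fintype_card, Fintype.card_subtype] at h1
    have h3 : ((E j).card : ℝ) * (2 * (2 ^ b * ((j + 1 : ℕ) : ℝ))) ≤ Nat.card (Og B) := by
      exact_mod_cast h1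
    have hp1 : (0 : ℝ) < 2 ^ b := by positivity
    have hp2 : (0 : ℝ) < ((j + 1 : ℕ) : ℝ) := by positivity
    rw [div_mul_eq_mul_div, le_div_iff₀ (by positivity), ← div_eq_mul_inv, le_div_iff₀ hp2]
    linarith
  have hcard : (Nat.card {g : Og B // 2 ^ s ∣ orderOf g} : ℝ) = (bad.card : ℝ) := by
    rw [Nat.card_eq_fintype_card, Fintype.card_subtype]
  rw [hcard]
  have hle : (bad.card : ℝ) ≤ (Nat.card (Og B) : ℝ) / (2 * 2 ^ b) * (harmonic N : ℝ) := by
    calc (bad.card : ℝ) ≤ (((Finset.range N).biUnion (fun j => E j)).card : ℝ) := by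
          exact_mod_cast Finset.card_le_card hsub
      _ ≤ ∑ j ∈ Finset.range N, ((E j).card : ℝ) := by
          exact_mod_cast Finset.card_biUnion_le
      _ ≤ ∑ j ∈ Finset.range N, (Nat.card (Og B) : ℝ) / (2 * 2 ^ b) * ((j + 1 : ℕ) : ℝ)⁻¹ :=
          Finset.sum_le_sum fun j _ => hE j
      _ = _ := by
          rw [← Finset.mul_sum, harmonic]
          push_cast
          rfl
  have hH : (harmonic N : ℝ) ≤ 2 ^ b := by
    refine (harmonic_le_one_add_log N).trans ?_
    have : Real.log N ≤ Real.log m := by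
      rcases Nat.eq_zero_or_pos N with h0 | h0
      · rw [h0]
        simp only [Nat.cast_zero, Real.log_zero]
        exact Real.log_natCast_nonneg m
      · apply Real.log_le_log (by exact_mod_cast h0)
        exact_mod_cast Nat.div_le_self _ _
    linarith
  refine hle.trans ?_
  have hp1 : (0 : ℝ) < 2 ^ b := by positivity
  calc (Nat.card (Og B) : ℝ) / (2 * 2 ^ b) * (harmonic N : ℝ)
      ≤ (Nat.card (Og B) : ℝ) / (2 * 2 ^ b) * 2 ^ b := by gcongr
    _ = _ := by field_simp

end

end OrthCount

namespace OrthCount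

open Module Polynomial

section

variable {F W : Type*} [Field F] [AddCommGroup W] [Module F W]
variable {K : Type*} [Field K] [Algebra F K]

/-- The form on `(K × K) × W`: hyperbolic trace form plus the given one. -/
noncomputable def bigForm (K : Type*) [Field K] [Algebra F K] (C : LinearMap.BilinForm F W) :
    LinearMap.BilinForm F ((K × K) × W) :=
  LinearMap.mk₂ F (fun u v => hyp (Algebra.traceForm F K) u.1 v.1 + C u.2 v.2)
    (by intros; simp; ring) (by intros; simp; ring) (by intros; simp; ring) (by intros; simp; ring)

theorem bigForm_apply (C : LinearMap.BilinForm F W) (u v : (K × K) × W) :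
    bigForm K C u v = Algebra.trace F K (u.1.1 * v.1.2) + Algebra.trace F K (v.1.1 * u.1.2)
      + C u.2 v.2 := rfl

/-- The standard elements. -/
noncomputable def std (C : LinearMap.BilinForm F W) : Kˣ × Og C →* Og (bigForm K C) where
  toFun p := ⟨((mulEquiv F p.1).prodCongr (mulEquiv F p.1⁻¹)).prodCongr (p.2 : W ≃ₗ[F] W), by
    intro u v
    have h1 : ∀ x y : K, (p.1 : K) * x * (((p.1⁻¹ : Kˣ) : K) * y) = x * y := by
      intro x y
      have : (p.1 : K) * ((p.1⁻¹ : Kˣ) : K) = 1 := p.1.mul_inv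
      linear_combination x * y * this
    have h3 := p.2.2 u.2 v.2
    simp only [bigForm_apply, LinearEquiv.prodCongr_apply, mulEquiv_apply, h1, h3]⟩
  map_one' := by
    apply Subtype.ext; ext <;> simp
  map_mul' a b := by
    apply Subtype.ext
    apply LinearEquiv.ext
    rintro ⟨⟨x, y⟩, w⟩
    simp [mul_assoc, mul_comm, mul_left_comm]

theorem std_apply (C : LinearMap.BilinForm F W) (a : Kˣ) (g : Og C) (u : (K × K) × W) :
    ((std C (a, g) : Og (bigForm K C)) : ((K × K) × W) ≃ₗ[F] ((K × K) × W)) u =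
      ((a * u.1.1, ((a⁻¹ : Kˣ) : K) * u.1.2), (g : W ≃ₗ[F] W) u.2) := rfl

theorem std_injective (C : LinearMap.BilinForm F W) :
    Function.Injective (std (K := K) C) := by
  rintro ⟨a, g⟩ ⟨a', g'⟩ h
  have h' : ∀ u : (K × K) × W, _ = _ := fun u =>
    (std_apply C a g u).symm.trans ((congrArg (fun z : Og (bigForm K C) =>
      (z : ((K × K) × W) ≃ₗ[F] ((K × K) × W)) u) h).trans (std_apply C a' g' u))
  have ha : a = a' := by
    have := h' ((1, 0), 0)
    simp only [Prod.mk.injEq, mul_one] at this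
    exact Units.ext this.1.1
  have hg : g = g' := by
    apply Subtype.ext; ext w
    have := h' ((0, 0), w)
    simp only [Prod.mk.injEq] at this
    exact this.2
  rw [ha, hg]

/-- A map intertwining two multiplications is zero or semilinear. -/
theorem semilinear [FiniteDimensional F K] [IsGalois F K] (a a' : K)
    (hgen : ∀ z : K, ∃ p : F[X], aeval a p = z) (γ : K →ₗ[F] K)
    (hγ : ∀ x, γ (a * x) = a' * γ x) :
    (∀ x, γ x = 0) ∨ ∃ (σ : K ≃ₐ[F] K) (c : Kˣ), σ a = a' ∧ ∀ x, γ x = c * σ x := by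
  have h1 : ∀ (p : F[X]) x, γ (aeval a p * x) = aeval a' p * γ x := by
    intro p
    induction p using Polynomial.induction_on' with
    | add p r hp hr => intro x; simp only [map_add, add_mul, hp, hr]
    | monomial n k =>
      have hn : ∀ x, γ (a ^ n * x) = a' ^ n * γ x := by
        induction n with
        | zero => simp
        | succ n ih => intro x; rw [pow_succ, mul_assoc, ih, hγ, pow_succ, mul_assoc]
      intro x
      rw [aeval_monomial, aeval_monomial, mul_assoc, mul_assoc, ← Algebra.smul_def,
        ← Algebra.smul_def, map_smul, hn]
  by_cases h0 : γ 1 = 0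
  · left
    intro x
    obtain ⟨p, rfl⟩ := hgen x
    have := h1 p 1
    rwa [mul_one, h0, mul_zero] at this
  · right
    have h : aeval a' (minpoly F a) = 0 := by
      have := h1 (minpoly F a) 1
      rw [minpoly.aeval, zero_mul, map_zero] at this
      rcases mul_eq_zero.1 this.symm with h | h
      · exact h
      · exact absurd h h0
    have ha : IsIntegral F a := Algebra.IsIntegral.isIntegral a
    have e := minpoly.eq_of_irreducible_of_monic (minpoly.irreducible ha) h (minpoly.monic ha)
    have hc : IsConjRoot F a' a := by rw [isConjRoot_def, ← e]
    obtain ⟨σ, hσ⟩ := isConjRoot_iff_exists_algEquiv.1 hc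
    refine ⟨σ, Units.mk0 _ h0, hσ, fun x => ?_⟩
    obtain ⟨p, rfl⟩ := hgen x
    have := h1 p 1
    rw [mul_one] at this
    rw [this, Units.val_mk0, mul_comm, ← hσ, aeval_algHom_apply]

/-- Standard shape of an intertwiner. -/
def Shape (C : LinearMap.BilinForm F W) (z : Og (bigForm K C)) (σ : K ≃ₐ[F] K) (c : Kˣ)
    (r : Og C) : Prop :=
  (∀ x, (z : ((K × K) × W) ≃ₗ[F] ((K × K) × W)) ((x, 0), 0) = ((c * σ x, 0), 0)) ∧
  (∀ y, ((z : ((K × K) × W) ≃ₗ[F] ((K × K) × W)) ((0, y), 0)).1.1 = 0) ∧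
  (∀ y, ((z : ((K × K) × W) ≃ₗ[F] ((K × K) × W)) ((0, y), 0)).2 = 0) ∧
  (∀ w, (z : ((K × K) × W) ≃ₗ[F] ((K × K) × W)) ((0, 0), w) = ((0, 0), (r : W ≃ₗ[F] W) w))

theorem Shape.unique [FiniteDimensional F K] [Algebra.IsSeparable F K] {C : LinearMap.BilinForm F W}
    {z z' : Og (bigForm K C)}
    {σ : K ≃ₐ[F] K} {c : Kˣ} {r : Og C} (h : Shape C z σ c r) (h' : Shape C z' σ c r) : z = z' := by
  have hT := traceForm_nondegenerate F K
  have key : ∀ y, (z : ((K × K) × W) ≃ₗ[F] ((K × K) × W)) ((0, y), 0) =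
      (z' : ((K × K) × W) ≃ₗ[F] ((K × K) × W)) ((0, y), 0) := by
    intro y
    refine Prod.ext (Prod.ext ?_ ?_) ?_
    · rw [h.2.1, h'.2.1]
    · rw [← sub_eq_zero]
      apply hT.2
      intro v
      have e1 := z.2 ((σ.symm ((c : K)⁻¹ * v), 0), 0) ((0, y), 0)
      have e2 := z'.2 ((σ.symm ((c : K)⁻¹ * v), 0), 0) ((0, y), 0)
      rw [← e2, h.1, h'.1] at e1
      simp only [bigForm_apply, mul_zero, map_zero, LinearMap.zero_apply, add_zero,
        AlgEquiv.apply_symm_apply, ne_eq, Units.ne_zero, not_false_eq_true,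
        mul_inv_cancel_left₀] at e1
      rw [Algebra.traceForm_apply, mul_sub, map_sub, e1, sub_self]
    · rw [h.2.2.1, h'.2.2.1]
  apply Subtype.ext
  apply LinearEquiv.ext
  rintro ⟨⟨x, y⟩, w⟩
  have e : (((x, y), w) : (K × K) × W) = ((x, 0), 0) + ((0, y), 0) + ((0, 0), w) := by simp
  rw [e]
  simp only [map_add, key, h.1, h'.1, h.2.2.2, h'.2.2.2]

theorem shape_of [FiniteDimensional F K] [IsGalois F K] (h2 : (2 : F) ≠ 0)
    {C : LinearMap.BilinForm F W} (z : Og (bigForm K C)) (a a₀ : Kˣ) (g g₀ : Og C)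
    (hgen : ∀ z : K, ∃ p : F[X], aeval (a : K) p = z)
    (hconj : ∀ σ : K ≃ₐ[F] K, σ a ≠ (a : K)⁻¹)
    (hz : z * std C (a, g) = std C (a₀, g₀) * z)
    (hι : ∀ u : (K × K) × W, (z : ((K × K) × W) ≃ₗ[F] ((K × K) × W)) (-u.1, u.2) =
      (-((z : ((K × K) × W) ≃ₗ[F] ((K × K) × W)) u).1,
        ((z : ((K × K) × W) ≃ₗ[F] ((K × K) × W)) u).2))
    (hne : ∃ x, ((z : ((K × K) × W) ≃ₗ[F] ((K × K) × W)) ((x, 0), 0)).1.1 ≠ 0) [Finite W] :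
    ∃ σ c r, Shape C z σ c r := by
  set Z := (z : ((K × K) × W) ≃ₗ[F] ((K × K) × W)) with hZ
  have hz' : ∀ u : (K × K) × W, Z ((a * u.1.1, ((a⁻¹ : Kˣ) : K) * u.1.2), (g : W ≃ₗ[F] W) u.2) =
      ((a₀ * (Z u).1.1, ((a₀⁻¹ : Kˣ) : K) * (Z u).1.2), (g₀ : W ≃ₗ[F] W) (Z u).2) := by
    intro u
    exact congrArg (fun k : Og (bigForm K C) => (k : ((K × K) × W) ≃ₗ[F] ((K × K) × W)) u) hz
  have hU : ∀ p : K × K, (Z (p, 0)).2 = 0 := by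
    intro p
    have h1 := hι (p, 0)
    have e : ((-p, 0) : (K × K) × W) = -(p, 0) := by simp
    simp only [] at h1
    rw [e, map_neg] at h1
    have h3 := congrArg Prod.snd h1
    simp only [Prod.snd_neg] at h3
    have h4 : (2 : F) • (Z (p, 0)).2 = 0 := by
      rw [two_smul]; nth_rewrite 1 [← h3]; simp
    exact (smul_eq_zero.1 h4).resolve_left h2
  have hW : ∀ w : W, (Z ((0, 0), w)).1 = 0 := by
    intro w
    have h1 := hι ((0, 0), w)
    have e : ((-((0, 0) : K × K), w) : (K × K) × W) = ((0, 0), w) := by simp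
    simp only [] at h1
    rw [e] at h1
    have h3 := congrArg Prod.fst h1
    simp only [] at h3
    have h4 : (2 : F) • (Z ((0, 0), w)).1 = 0 := by
      rw [two_smul]; nth_rewrite 1 [h3]; simp
    exact (smul_eq_zero.1 h4).resolve_left h2
  let i1 : K →ₗ[F] (K × K) × W := LinearMap.inl F (K × K) W ∘ₗ LinearMap.inl F K K
  let i2 : K →ₗ[F] (K × K) × W := LinearMap.inl F (K × K) W ∘ₗ LinearMap.inr F K K
  let p1 : (K × K) × W →ₗ[F] K := LinearMap.fst F K K ∘ₗ LinearMap.fst F (K × K) W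
  let p2 : (K × K) × W →ₗ[F] K := LinearMap.snd F K K ∘ₗ LinearMap.fst F (K × K) W
  let α : K →ₗ[F] K := p1 ∘ₗ (Z : ((K × K) × W) →ₗ[F] ((K × K) × W)) ∘ₗ i1
  let β : K →ₗ[F] K := p2 ∘ₗ (Z : ((K × K) × W) →ₗ[F] ((K × K) × W)) ∘ₗ i1
  let α' : K →ₗ[F] K := p1 ∘ₗ (Z : ((K × K) × W) →ₗ[F] ((K × K) × W)) ∘ₗ i2
  have hα : ∀ x, α x = (Z ((x, 0), 0)).1.1 := fun x => rfl
  have hβ : ∀ x, β x = (Z ((x, 0), 0)).1.2 := fun x => rfl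
  have hα' : ∀ x, α' x = (Z ((0, x), 0)).1.1 := fun x => rfl
  have s1 : ∀ x, α (a * x) = a₀ * α x := by
    intro x
    have := congrArg (fun v => v.1.1) (hz' ((x, 0), 0))
    simp only [mul_zero, map_zero] at this
    exact this
  have s2 : ∀ x, β (a * x) = ((a₀⁻¹ : Kˣ) : K) * β x := by
    intro x
    have := congrArg (fun v => v.1.2) (hz' ((x, 0), 0))
    simp only [mul_zero, map_zero] at this
    exact this
  have s3 : ∀ x, α' (a * x) = ((a₀⁻¹ : Kˣ) : K) * α' x := by
    intro x
    have := congrArg (fun v => v.1.1) (hz' ((0, a * x), 0))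
    simp only [mul_zero, map_zero, Units.inv_mul_cancel_left] at this
    rw [hα', hα', this, Units.inv_mul_cancel_left]
  rcases semilinear (a : K) a₀ hgen α s1 with h0 | ⟨σ, c, hσ, hc⟩
  · obtain ⟨x, hx⟩ := hne
    exact absurd (h0 x) hx
  have notinv : ∀ τ : K ≃ₐ[F] K, τ a ≠ ((a₀⁻¹ : Kˣ) : K) := by
    intro τ hτ
    rw [Units.val_inv_eq_inv_val, ← hσ, ← map_inv₀] at hτ
    apply hconj (τ.trans σ.symm)
    change σ.symm (τ a) = _
    rw [hτ]; exact σ.symm_apply_apply _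
  have hβ0 : ∀ x, β x = 0 := by
    rcases semilinear (a : K) _ hgen β s2 with h0 | ⟨τ, _, hτ, _⟩
    · exact h0
    · exact absurd hτ (notinv τ)
  have hα0 : ∀ x, α' x = 0 := by
    rcases semilinear (a : K) _ hgen α' s3 with h0 | ⟨τ, _, hτ, _⟩
    · exact h0
    · exact absurd hτ (notinv τ)
  let ρ : W →ₗ[F] W := LinearMap.snd F (K × K) W ∘ₗ
    (Z : ((K × K) × W) →ₗ[F] ((K × K) × W)) ∘ₗ LinearMap.inr F (K × K) W
  have hρ : ∀ w, Z ((0, 0), w) = ((0, 0), ρ w) := by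
    intro w
    exact Prod.ext (hW w) rfl
  have hρinj : Function.Injective ρ := by
    rw [← LinearMap.ker_eq_bot, LinearMap.ker_eq_bot']
    intro w hw
    have := hρ w
    rw [hw] at this
    have h0 : Z ((0, 0), w) = Z 0 := by rw [this, map_zero]; rfl
    exact congrArg Prod.snd (Z.injective h0)
  let r : W ≃ₗ[F] W := LinearEquiv.ofBijective ρ (Finite.injective_iff_bijective.1 hρinj)
  have hr : r ∈ Og C := by
    intro x y
    change C (ρ x) (ρ y) = _
    have := z.2 ((0, 0), x) ((0, 0), y)
    rw [← hZ, hρ, hρ] at this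
    simpa [bigForm_apply] using this
  refine ⟨σ, c, ⟨r, hr⟩, ?_, hα0, fun y => hU _, hρ⟩
  intro x
  refine Prod.ext (Prod.ext ?_ ?_) (hU _)
  · exact hc x
  · exact hβ0 x

/-- The swap. -/
def swp (C : LinearMap.BilinForm F W) : Og (bigForm K C) :=
  ⟨(LinearEquiv.prodComm F K K).prodCongr (LinearEquiv.refl F W), by
    intro u v
    simp [bigForm_apply, mul_comm]; ring⟩

theorem swp_apply (C : LinearMap.BilinForm F W) (u : (K × K) × W) :
    ((swp C : Og (bigForm K C)) : ((K × K) × W) ≃ₗ[F] ((K × K) × W)) u =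
      ((u.1.2, u.1.1), u.2) := rfl

theorem swp_std (C : LinearMap.BilinForm F W) (a : Kˣ) (g : Og C) :
    swp C * std C (a, g) = std (K := K) C (a⁻¹, g) * swp C := by
  apply Subtype.ext
  apply LinearEquiv.ext
  intro u
  have : (((a⁻¹ * u.1.2 : K), (a : K) * u.1.1), (g : W ≃ₗ[F] W) u.2) =
    ((((a⁻¹ : Kˣ) : K) * u.1.2, (((a⁻¹)⁻¹ : Kˣ) : K) * u.1.1), (g : W ≃ₗ[F] W) u.2) := by
    simp
  rw [Units.val_inv_eq_inv_val] at this
  simpa [swp_apply, std_apply] using this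

end

end OrthCount

namespace OrthCount

open Module Polynomial

theorem lcm_facts {A G s : ℕ} (hA : A ≠ 0) (hG : G ≠ 0) (h1 : 2 ^ s ∣ A) (h2 : ¬ 2 ^ s ∣ G) :
    G ∣ Nat.lcm A G / 2 ∧ ¬ A ∣ Nat.lcm A G / 2 := by
  obtain ⟨α, A', hA', rfl⟩ := Nat.exists_eq_two_pow_mul_odd hA
  obtain ⟨β, G', hG', rfl⟩ := Nat.exists_eq_two_pow_mul_odd hG
  have hβ : β < s := by
    by_contra h
    exact h2 (Dvd.dvd.mul_right (pow_dvd_pow 2 (by omega)) _)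
  have hα : s ≤ α := by
    have hc : Nat.Coprime (2 ^ s) A' := Nat.Coprime.pow_left _ (Nat.coprime_two_left.2 hA')
    have := hc.dvd_of_dvd_mul_right h1
    exact (Nat.pow_dvd_pow_iff_le_right (by norm_num)).1 this
  set N := Nat.lcm (2 ^ α * A') (2 ^ β * G') with hN
  have hAN : 2 ^ α * A' ∣ N := Nat.dvd_lcm_left _ _
  have hGN : 2 ^ β * G' ∣ N := Nat.dvd_lcm_right _ _
  have hNd : N ∣ 2 ^ α * (A' * G') := by
    apply Nat.lcm_dvd
    · exact ⟨G', by ring⟩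
    · exact mul_dvd_mul (pow_dvd_pow 2 (by omega)) (Dvd.intro_left _ rfl)
  have h2N : 2 ^ (β + 1) ∣ N :=
    ((pow_dvd_pow 2 (by omega : β + 1 ≤ α)).trans (Dvd.intro _ rfl)).trans hAN
  obtain ⟨k, hk⟩ := h2N
  have hk2 : N / 2 = 2 ^ β * k := by
    rw [hk, pow_succ]
    have : 2 ^ β * 2 * k = 2 ^ β * k * 2 := by ring
    rw [this, Nat.mul_div_cancel _ (by norm_num)]
  constructor
  · have hG2 : G' ∣ N := (Dvd.intro_left _ rfl).trans hGN
    rw [hk2]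
    apply mul_dvd_mul_left
    rw [hk] at hG2
    have hc : Nat.Coprime G' (2 ^ (β + 1)) :=
      (Nat.Coprime.pow_left _ (Nat.coprime_two_left.2 hG')).symm
    exact hc.dvd_of_dvd_mul_left hG2
  · intro h
    have h3 : 2 ^ α * 2 ∣ N := by
      have e : N = N / 2 * 2 := by
        rw [hk2, hk]; ring
      rw [e]
      exact mul_dvd_mul_right ((Dvd.intro _ rfl).trans h) 2
    have h4 := h3.trans hNd
    have h5 := Nat.dvd_of_mul_dvd_mul_left (by positivity) h4
    exact (Nat.not_even_iff_odd.2 (hA'.mul hG')) (even_iff_two_dvd.2 h5)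

theorem card_le_of_fibre {X T D : Type*} [Finite T] [Finite D] (π : X → T) (P : X → X → D → Prop)
    (ex : ∀ x0 x, π x0 = π x → ∃ d, P x0 x d)
    (un : ∀ x0 x x' d, π x0 = π x → π x0 = π x' → P x0 x d → P x0 x' d → x = x') :
    Nat.card X ≤ Nat.card T * Nat.card D := by
  rw [← Nat.card_prod]
  rcases isEmpty_or_nonempty X with hX | hX
  · simp
  have h0 : ∀ x, π (Function.invFun π (π x)) = π x := fun x => Function.invFun_eq ⟨x, rfl⟩
  choose d hd using fun x => ex _ x (h0 x)
  apply Nat.card_le_card_of_injective (fun x => (π x, d x))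
  intro x x' h
  simp only [Prod.mk.injEq] at h
  have h1 := hd x
  have h2 := hd x'
  rw [← h.1, ← h.2] at h2
  exact un _ x x' _ (h0 x) ((h0 x).trans h.1) h1 h2

section

variable {F V : Type*} [Field F] [AddCommGroup V] [Module F V]

/-- Dimension of the `(-1)`-eigenspace. -/
noncomputable def eigd (g : V ≃ₗ[F] V) : ℕ :=
  finrank F (LinearMap.ker ((g : V →ₗ[F] V) + 1))

/-- The elements of interest. -/
def Tset (B : LinearMap.BilinForm F V) (d : ℕ) : Set (Og B) :=
  {h | 4 ∣ orderOf h ∧ eigd ((h ^ (orderOf h / 2) : Og B) : V ≃ₗ[F] V) = d}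

end

section

variable {F W : Type*} [Field F] [AddCommGroup W] [Module F W]
variable {K : Type*} [Field K] [Algebra F K]

theorem eigd_neg (h2 : (2 : F) ≠ 0) [FiniteDimensional F K] (C : LinearMap.BilinForm F W) :
    eigd ((std C ((-1 : Kˣ), (1 : Og C)) : Og (bigForm K C)) :
      ((K × K) × W) ≃ₗ[F] ((K × K) × W)) = 2 * finrank F K := by
  unfold eigd
  have : LinearMap.ker ((((std C ((-1 : Kˣ), (1 : Og C)) : Og (bigForm K C)) :
      ((K × K) × W) ≃ₗ[F] ((K × K) × W)) : ((K × K) × W) →ₗ[F] ((K × K) × W)) + 1) =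
      LinearMap.range (LinearMap.inl F (K × K) W) := by
    ext u
    rw [LinearMap.mem_ker, LinearMap.add_apply, LinearEquiv.coe_coe, std_apply]
    obtain ⟨⟨x, y⟩, w⟩ := u
    have hw : w + w = 0 ↔ w = 0 := by
      constructor
      · intro h
        rw [← two_smul F] at h
        exact (smul_eq_zero.1 h).resolve_left h2
      · rintro rfl; simp
    simp only [LinearMap.mem_range, LinearMap.inl_apply]
    simp [Prod.ext_iff, hw, eq_comm (a := (0:W))]
  rw [this, LinearMap.finrank_range_of_inj LinearMap.inl_injective, finrank_prod]
  ring

variable [Finite F] [Finite K] [Finite W]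

theorem std_half (C : LinearMap.BilinForm F W) {s : ℕ} (hs : 2 ≤ s) (a : Kˣ) (g : Og C)
    (ha : 2 ^ s ∣ orderOf a) (hg : ¬ 2 ^ s ∣ orderOf g) :
    4 ∣ orderOf (std C (a, g)) ∧
    std C (a, g) ^ (orderOf (std C (a, g)) / 2) = std C ((-1 : Kˣ), 1) := by
  have ho : orderOf (std C (a, g)) = Nat.lcm (orderOf a) (orderOf g) := by
    rw [orderOf_injective _ (std_injective C), Prod.orderOf]
  have h4 : 4 ∣ orderOf (std C (a, g)) := by
    rw [ho]
    exact ((pow_dvd_pow 2 hs).trans ha).trans (Nat.dvd_lcm_left _ _)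
  refine ⟨h4, ?_⟩
  obtain ⟨f1, f2⟩ := lcm_facts (orderOf_pos a).ne' (orderOf_pos g).ne' ha hg
  rw [← ho] at f1 f2
  rw [← map_pow, Prod.pow_mk]
  congr 2
  · have h1 : a ^ (orderOf (std C (a, g)) / 2) ≠ 1 := by
      intro h; exact f2 (orderOf_dvd_of_pow_eq_one h)
    have h2 : (a ^ (orderOf (std C (a, g)) / 2)) ^ 2 = 1 := by
      rw [← pow_mul, Nat.div_mul_cancel (dvd_trans (by norm_num) h4), ho]
      exact orderOf_dvd_iff_pow_eq_one.1 (Nat.dvd_lcm_left _ _)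
    apply Units.ext
    have h3 := congrArg Units.val h2
    rw [Units.val_pow_eq_pow_val, Units.val_one] at h3
    rw [sq] at h3
    rcases mul_self_eq_one_iff.1 h3 with h | h
    · exact absurd (Units.ext h) h1
    · rw [h]; simp
  · exact orderOf_dvd_iff_pow_eq_one.1 f1

theorem std_mem (h2 : (2 : F) ≠ 0) (C : LinearMap.BilinForm F W) {s : ℕ} (hs : 2 ≤ s) (a : Kˣ)
    (g : Og C) (ha : 2 ^ s ∣ orderOf a) (hg : ¬ 2 ^ s ∣ orderOf g) (y : Og (bigForm K C)) :
    y * std C (a, g) * y⁻¹ ∈ Tset (bigForm K C) (2 * finrank F K) := by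
  have ho : orderOf (y * std C (a, g) * y⁻¹) = orderOf (std C (a, g)) := by
    exact orderOf_injective (MulAut.conj y).toMonoidHom (MulAut.conj y).injective _
  obtain ⟨h4, hh⟩ := std_half C hs a g ha hg
  refine ⟨ho ▸ h4, ?_⟩
  rw [ho, conj_pow, hh, ← eigd_neg h2 C]
  set i := (std C ((-1 : Kˣ), (1 : Og C)) : Og (bigForm K C))
  unfold eigd
  have e : LinearMap.ker ((((y * i * y⁻¹ : Og (bigForm K C)) :
      ((K × K) × W) ≃ₗ[F] ((K × K) × W)) : ((K × K) × W) →ₗ[F] ((K × K) × W)) + 1) =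
      (LinearMap.ker (((i : ((K × K) × W) ≃ₗ[F] ((K × K) × W)) :
        ((K × K) × W) →ₗ[F] ((K × K) × W)) + 1)).map
        ((y : ((K × K) × W) ≃ₗ[F] ((K × K) × W)) : ((K × K) × W) →ₗ[F] ((K × K) × W)) := by
    ext u
    rw [Submodule.mem_map_equiv, LinearMap.mem_ker, LinearMap.mem_ker]
    set Y := (y : ((K × K) × W) ≃ₗ[F] ((K × K) × W))
    have : Y.symm u = 0 ↔ u = 0 := by simp
    change Y ((i : ((K × K) × W) ≃ₗ[F] ((K × K) × W)) (Y.symm u)) + u = 0 ↔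
      (i : ((K × K) × W) ≃ₗ[F] ((K × K) × W)) (Y.symm u) + Y.symm u = 0
    rw [← Y.symm.map_eq_zero_iff, map_add, Y.symm_apply_apply]
  rw [e]
  exact LinearEquiv.finrank_map_eq _ _

theorem commutes_of (C : LinearMap.BilinForm F W) {s : ℕ} (hs : 2 ≤ s) (a a₀ : Kˣ)
    (g g₀ : Og C) (ha : 2 ^ s ∣ orderOf a) (hg : ¬ 2 ^ s ∣ orderOf g)
    (ha₀ : 2 ^ s ∣ orderOf a₀) (hg₀ : ¬ 2 ^ s ∣ orderOf g₀)
    (z : Og (bigForm K C)) (hz : z * std C (a, g) = std C (a₀, g₀) * z) :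
    z * std C ((-1 : Kˣ), 1) = std C ((-1 : Kˣ), 1) * z := by
  have hs' : SemiconjBy z (std C (a, g)) (std C (a₀, g₀)) := hz
  have ho : orderOf (std C (a₀, g₀)) = orderOf (std C (a, g)) := by
    have : std C (a₀, g₀) = MulAut.conj z (std C (a, g)) := by
      rw [MulAut.conj_apply, hz, mul_inv_cancel_right]
    rw [this]
    exact orderOf_injective (MulAut.conj z).toMonoidHom (MulAut.conj z).injective _
  have h1 := hs'.pow_right (orderOf (std C (a, g)) / 2)
  rw [(std_half C hs a g ha hg).2, ← ho, (std_half C hs a₀ g₀ ha₀ hg₀).2] at h1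
  exact h1

/-- Good torus elements. -/
def Lam (F K : Type*) [Field F] [Field K] [Algebra F K] (s : ℕ) : Set Kˣ :=
  {a | 2 ^ s ∣ orderOf a ∧ ∀ z : K, ∃ p : F[X], aeval (a : K) p = z}

theorem fibre_bound {q b s : ℕ} (h2 : (2 : F) ≠ 0) (hq : q = Nat.card F) (h : Arith q b s)
    [FiniteDimensional F K] [IsGalois F K] (C : LinearMap.BilinForm F W) :
    Nat.card (Og (bigForm K C)) * (Nat.card (Lam F K s) *
      Nat.card {g : Og C // ¬ 2 ^ s ∣ orderOf g}) ≤
    Nat.card (Tset (bigForm K C) (2 * finrank F K)) *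
      (2 * (finrank F K * (Nat.card Kˣ * Nat.card (Og C)))) := by
  have hs := h.two_le_s
  have hD : 2 * (finrank F K * (Nat.card Kˣ * Nat.card (Og C))) =
      Nat.card (Bool × (K ≃ₐ[F] K) × Kˣ × Og C) := by
    simp only [Nat.card_prod, IsGalois.card_aut_eq_finrank]
    simp
  rw [hD, ← Nat.card_prod, ← Nat.card_prod]
  have : Finite (K ≃ₐ[F] K) := inferInstance
  let X := Og (bigForm K C) × (Lam F K s) × {g : Og C // ¬ 2 ^ s ∣ orderOf g}
  let π : X → Tset (bigForm K C) (2 * finrank F K) := fun x =>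
    ⟨x.1 * std C (x.2.1.1, x.2.2.1) * x.1⁻¹, std_mem h2 C hs _ _ x.2.1.2.1 x.2.2.2 _⟩
  let P : X → X → Bool × (K ≃ₐ[F] K) × Kˣ × Og C → Prop := fun x0 x d =>
    Shape C (if d.1 then x0.1⁻¹ * x.1 else swp C * (x0.1⁻¹ * x.1)) d.2.1 d.2.2.1 d.2.2.2
  have hπ : ∀ x0 x, π x0 = π x → (x0.1⁻¹ * x.1) * std C (x.2.1.1, x.2.2.1) =
      std C (x0.2.1.1, x0.2.2.1) * (x0.1⁻¹ * x.1) := by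
    intro x0 x hx
    have hx := congrArg Subtype.val hx
    simp only [π] at hx
    rw [eq_mul_inv_iff_mul_eq] at hx
    rw [mul_assoc, ← hx]
    group
  apply card_le_of_fibre π P
  · intro x0 x hx
    have hz := hπ x0 x hx
    set z := x0.1⁻¹ * x.1 with hzdef
    have hl : ∀ σ : K ≃ₐ[F] K, σ (x.2.1.1 : K) ≠ (x.2.1.1 : K)⁻¹ := by
      intro σ
      refine conj_ne hq h _ x.2.1.1.ne_zero ?_ σ
      rw [orderOf_units]
      exact x.2.1.2.1
    have key : ∀ (z : Og (bigForm K C)) (a₀ : Kˣ), 2 ^ s ∣ orderOf a₀ →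
        z * std C (x.2.1.1, x.2.2.1) = std C (a₀, x0.2.2.1) * z →
        (∃ k, ((z : ((K × K) × W) ≃ₗ[F] ((K × K) × W)) ((k, 0), 0)).1.1 ≠ 0) →
        ∃ σ c r, Shape C z σ c r := by
      intro z a₀ ha₀ hz hne
      refine shape_of h2 z x.2.1.1 a₀ x.2.2.1 x0.2.2.1 x.2.1.2.2 hl hz ?_ hne
      have hc := commutes_of C hs _ _ _ _ x.2.1.2.1 x.2.2.2 ha₀ x0.2.2.2 z hz
      intro u
      have := congrArg (fun k : Og (bigForm K C) =>
        (k : ((K × K) × W) ≃ₗ[F] ((K × K) × W)) u) hc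
      simp only [Subgroup.coe_mul, LinearEquiv.mul_apply, std_apply] at this
      rw [show -u.1 = (-u.1.1, -u.1.2) from rfl]
      simpa [Prod.ext_iff] using this
    by_cases hne : ∃ k, ((z : ((K × K) × W) ≃ₗ[F] ((K × K) × W)) ((k, 0), 0)).1.1 ≠ 0
    · obtain ⟨σ, c, r, hsh⟩ := key z _ x0.2.1.2.1 hz hne
      exact ⟨(true, σ, c, r), by simpa [P] using hsh⟩
    · have hz' : (swp C * z) * std C (x.2.1.1, x.2.2.1) =
          std C (x0.2.1.1⁻¹, x0.2.2.1) * (swp C * z) := by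
        rw [mul_assoc, hz, ← mul_assoc, swp_std, mul_assoc]
      push Not at hne
      obtain ⟨σ, c, r, hsh⟩ := key (swp C * z) (x0.2.1.1⁻¹)
        (by rw [orderOf_inv]; exact x0.2.1.2.1) hz' (by
        by_contra hcon
        push Not at hcon
        have hU : ((z : ((K × K) × W) ≃ₗ[F] ((K × K) × W)) ((1, 0), 0)).2 = 0 := by
          have hc := commutes_of C hs _ _ _ _ x.2.1.2.1 x.2.2.2 x0.2.1.2.1 x0.2.2.2 z hz
          have := congrArg (fun k : Og (bigForm K C) =>
            (k : ((K × K) × W) ≃ₗ[F] ((K × K) × W)) ((1, 0), 0)) hc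
          have e : (std C ((-1 : Kˣ), (1 : Og C)) : ((K × K) × W) ≃ₗ[F] ((K × K) × W))
              ((1, 0), 0) = -((1, 0), 0) := by
            rw [std_apply]; simp
          simp only [Subgroup.coe_mul, LinearEquiv.mul_apply] at this
          rw [e, map_neg, std_apply] at this
          have h3 := congrArg Prod.snd this
          simp only [Prod.snd_neg] at h3
          have h4 : (2 : F) • ((z : ((K × K) × W) ≃ₗ[F] ((K × K) × W)) ((1, 0), 0)).2 = 0 := by
            rw [two_smul]; nth_rewrite 1 [← neg_neg ((z : ((K × K) × W) ≃ₗ[F] ((K × K) × W)) ((1, 0), 0)).2]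
            rw [h3]; simp
          exact (smul_eq_zero.1 h4).resolve_left h2
        have h5 : (z : ((K × K) × W) ≃ₗ[F] ((K × K) × W)) ((1, 0), 0) = 0 :=
          Prod.ext (Prod.ext (hne 1) (hcon 1)) hU
        rw [LinearEquiv.map_eq_zero_iff] at h5
        have := congrArg (fun v : (K × K) × W => v.1.1) h5
        simp at this)
      exact ⟨(false, σ, c, r), by simpa [P] using hsh⟩
  · intro x0 x x' d hx hx' hp hp'
    have hz := hπ x0 x hx
    have hz' := hπ x0 x' hx'
    have e := Shape.unique hp hp'
    have e1 : x.1 = x'.1 := by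
      by_cases hd : d.1 <;> simpa [hd] using e
    rw [e1, ← hz'] at hz
    have e2 := std_injective C (mul_left_cancel hz)
    simp only [Prod.mk.injEq] at e2
    exact Prod.ext e1 (Prod.ext (Subtype.ext e2.1) (Subtype.ext e2.2))

end

end OrthCount

namespace OrthCount

open Module Polynomial

theorem geom_bound {q : ℕ} (hq : 3 ≤ q) (r : ℕ) :
    2 * ∑ i ∈ Finset.Icc 1 r, (q ^ i - 1) ≤ 3 * (q ^ r - 1) := by
  induction r with
  | zero => simp
  | succ r ih =>
    rw [Finset.sum_Icc_succ_top (by omega), mul_add]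
    have h1 : 1 ≤ q ^ r := Nat.one_le_pow _ _ (by omega)
    have h2 : 3 * q ^ r ≤ q ^ (r + 1) := by rw [pow_succ, mul_comm]; gcongr
    omega

section

variable {F : Type*} [Field F]
variable {K : Type*} [Field K] [Algebra F K]

theorem gen_or_pow [Finite F] [Finite K] {q : ℕ} (hq : q = Nat.card F) (a : Kˣ)
    (hn : ¬ ∀ z : K, ∃ p : F[X], aeval (a : K) p = z) :
    ∃ i, 1 ≤ i ∧ i ≤ finrank F K / 2 ∧ a ^ (q ^ i - 1) = 1 := by
  have hfin : FiniteDimensional F K := Module.Finite.of_finite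
  let E := IntermediateField.adjoin F {(a : K)}
  have hmul := Module.finrank_mul_finrank F E K
  have hE : finrank E K ≠ 1 := by
    intro h1
    apply hn
    have htop : E = ⊤ := IntermediateField.finrank_eq_one_iff_eq_top.1 h1
    have hal : IsAlgebraic F (a : K) := Algebra.IsAlgebraic.isAlgebraic _
    have h2 := (IntermediateField.adjoin_simple_eq_top_iff_of_isAlgebraic hal).1 htop
    rw [Algebra.adjoin_singleton_eq_range_aeval] at h2
    intro z
    have : z ∈ (aeval (a : K) : F[X] →ₐ[F] K).range := by rw [h2]; trivial
    exact this
  have hpos : 0 < finrank E K := finrank_pos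
  have hpos' : 0 < finrank F E := finrank_pos
  refine ⟨finrank F E, hpos', ?_, ?_⟩
  · rw [Nat.le_div_iff_mul_le (by norm_num), ← hmul]
    exact Nat.mul_le_mul_left _ (by omega)
  · have hx : (a : K) ∈ E := IntermediateField.mem_adjoin_simple_self F _
    have : Fintype E := Fintype.ofFinite E
    have h1 := FiniteField.pow_card_sub_one_eq_one (⟨a, hx⟩ : E) (by
      intro h; exact a.ne_zero (congrArg Subtype.val h))
    rw [← Nat.card_eq_fintype_card, Module.natCard_eq_pow_finrank (K := F) (V := E), ← hq] at h1
    apply Units.ext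
    exact congrArg Subtype.val h1

theorem card_Lam_ge [Finite F] [Finite K] {q b s : ℕ} (hq : q = Nat.card F) (h : Arith q b s)
    (hq3 : 3 ≤ q) (hm : 2 ^ b ∣ finrank F K) :
    Nat.card Kˣ ≤ 3 * Nat.card (Lam F K s) := by
  classical
  have hfin : FiniteDimensional F K := Module.Finite.of_finite
  have : Fintype K := Fintype.ofFinite K
  set m := finrank F K with hmdef
  have hmpos : 0 < m := finrank_pos
  have h4 : 4 ∣ m := (pow_dvd_pow 2 h.two_le).trans hm
  obtain ⟨r, hr⟩ : ∃ r, m = 2 * r := by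
    obtain ⟨k, hk⟩ := h4; exact ⟨2 * k, by omega⟩
  have hr2 : 2 ≤ r := by have := Nat.le_of_dvd hmpos h4; omega
  have hcard : Fintype.card Kˣ = q ^ m - 1 := by
    rw [Fintype.card_units, ← Nat.card_eq_fintype_card, hq,
      Module.natCard_eq_pow_finrank (K := F) (V := K)]
  set M := q ^ m - 1 with hM
  have hdvd : 2 ^ s ∣ M := h.dvd.trans (Nat.pow_sub_one_dvd_pow_sub_one q hm)
  have hMe : 2 ∣ M := (dvd_pow_self 2 (by have := h.two_le_s; omega)).trans hdvd
  have hq9 : 9 ≤ q ^ r := by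
    calc 9 = 3 ^ 2 := by norm_num
      _ ≤ q ^ 2 := by gcongr
      _ ≤ q ^ r := Nat.pow_le_pow_right (by omega) hr2
  have hMr : M = (q ^ r - 1) * (q ^ r + 1) := by
    rw [hM, hr, mul_comm, pow_mul]
    have := Nat.sq_sub_sq (q ^ r) 1
    rw [one_pow] at this
    rw [this, mul_comm]
  have hMge : 9 * (q ^ r - 1) ≤ M := by
    rw [hMr, mul_comm]; exact Nat.mul_le_mul_left _ (by omega)
  have hMpos : 2 ≤ M := by omega
  have hcov : (Finset.univ : Finset Kˣ) ⊆
      (Finset.univ.filter (fun a : Kˣ => a ∈ Lam F K s)) ∪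
      ((Finset.univ.filter (fun a : Kˣ => a ^ (M / 2) = 1)) ∪
      ((Finset.Icc 1 r).biUnion
        (fun i => Finset.univ.filter (fun a : Kˣ => a ^ (q ^ i - 1) = 1)))) := by
    intro a _
    simp only [Finset.mem_union, Finset.mem_filter, Finset.mem_univ, true_and,
      Finset.mem_biUnion, Finset.mem_Icc]
    by_cases h1 : a ^ (M / 2) = 1
    · right; left; exact h1
    by_cases h2 : ∀ z : K, ∃ p : F[X], aeval (a : K) p = z
    · left
      refine ⟨two_pow_dvd_orderOf hdvd ?_ h1, h2⟩
      rw [← hcard]; exact pow_card_eq_one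
    · right; right
      obtain ⟨i, hi1, hi2, hi3⟩ := gen_or_pow hq a h2
      exact ⟨i, ⟨hi1, by omega⟩, hi3⟩
  have hc := Finset.card_le_card hcov
  rw [Finset.card_univ, hcard] at hc
  have e1 : (Finset.univ.filter (fun a : Kˣ => a ∈ Lam F K s)).card = Nat.card (Lam F K s) := by
    rw [Nat.card_eq_fintype_card, Fintype.card_subtype]
  have e2 : (Finset.univ.filter (fun a : Kˣ => a ^ (M / 2) = 1)).card ≤ M / 2 :=
    IsCyclic.card_pow_eq_one_le (by omega)
  have e3 : ((Finset.Icc 1 r).biUnion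
        (fun i => Finset.univ.filter (fun a : Kˣ => a ^ (q ^ i - 1) = 1))).card ≤
      ∑ i ∈ Finset.Icc 1 r, (q ^ i - 1) := by
    refine Finset.card_biUnion_le.trans (Finset.sum_le_sum fun i hi => ?_)
    apply IsCyclic.card_pow_eq_one_le
    rw [Finset.mem_Icc] at hi
    have : q ^ 1 ≤ q ^ i := Nat.pow_le_pow_right (by omega) hi.1
    rw [pow_one] at this
    omega
  have e4 := geom_bound hq3 r
  have hu1 := Finset.card_union_le (Finset.univ.filter (fun a : Kˣ => a ∈ Lam F K s))
    ((Finset.univ.filter (fun a : Kˣ => a ^ (M / 2) = 1)) ∪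
      ((Finset.Icc 1 r).biUnion
        (fun i => Finset.univ.filter (fun a : Kˣ => a ^ (q ^ i - 1) = 1))))
  have hu2 := Finset.card_union_le (Finset.univ.filter (fun a : Kˣ => a ^ (M / 2) = 1))
      ((Finset.Icc 1 r).biUnion
        (fun i => Finset.univ.filter (fun a : Kˣ => a ^ (q ^ i - 1) = 1)))
  rw [Nat.card_eq_fintype_card, hcard]
  omega

end

end OrthCount

namespace OrthCount

open Module Polynomial

section

variable {F V V' : Type*} [Field F] [AddCommGroup V] [Module F V] [AddCommGroup V'] [Module F V']

/-- Transport along an isometry. -/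
def ogMap {B : LinearMap.BilinForm F V} {B' : LinearMap.BilinForm F V'} (e : V ≃ₗ[F] V')
    (he : ∀ x y, B' (e x) (e y) = B x y) : Og B →* Og B' where
  toFun g := ⟨e.symm.trans ((g : V ≃ₗ[F] V).trans e), by
    intro x y
    have h1 := g.2 (e.symm x) (e.symm y)
    have h2 := he (e.symm x) (e.symm y)
    simp only [LinearEquiv.apply_symm_apply] at h2
    simp only [LinearEquiv.trans_apply, he]
    rw [h1, h2]⟩
  map_one' := by
    apply Subtype.ext; ext x; simp
  map_mul' a b := by
    apply Subtype.ext; ext x; simp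

theorem ogMap_apply {B : LinearMap.BilinForm F V} {B' : LinearMap.BilinForm F V'} (e : V ≃ₗ[F] V')
    (he : ∀ x y, B' (e x) (e y) = B x y) (g : Og B) (x : V') :
    (ogMap e he g : V' ≃ₗ[F] V') x = e ((g : V ≃ₗ[F] V) (e.symm x)) := rfl

theorem ogMap_injective {B : LinearMap.BilinForm F V} {B' : LinearMap.BilinForm F V'}
    (e : V ≃ₗ[F] V') (he : ∀ x y, B' (e x) (e y) = B x y) : Function.Injective (ogMap e he) := by
  intro g g' h
  apply Subtype.ext; apply LinearEquiv.ext; intro x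
  have := congrArg (fun k : Og B' => (k : V' ≃ₗ[F] V') (e x)) h
  simpa [ogMap_apply] using this

theorem eigd_ogMap {B : LinearMap.BilinForm F V} {B' : LinearMap.BilinForm F V'}
    (e : V ≃ₗ[F] V') (he : ∀ x y, B' (e x) (e y) = B x y) (g : Og B) :
    eigd (ogMap e he g : V' ≃ₗ[F] V') = eigd (g : V ≃ₗ[F] V) := by
  unfold eigd
  have : LinearMap.ker (((ogMap e he g : V' ≃ₗ[F] V') : V' →ₗ[F] V') + 1) =
      (LinearMap.ker (((g : V ≃ₗ[F] V) : V →ₗ[F] V) + 1)).map (e : V →ₗ[F] V') := by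
    ext u
    rw [Submodule.mem_map_equiv, LinearMap.mem_ker, LinearMap.mem_ker]
    change e ((g : V ≃ₗ[F] V) (e.symm u)) + u = 0 ↔ (g : V ≃ₗ[F] V) (e.symm u) + e.symm u = 0
    rw [← e.symm.map_eq_zero_iff, map_add, e.symm_apply_apply]
  rw [this]
  exact LinearEquiv.finrank_map_eq e _

theorem ogMap_mem {B : LinearMap.BilinForm F V} {B' : LinearMap.BilinForm F V'}
    (e : V ≃ₗ[F] V') (he : ∀ x y, B' (e x) (e y) = B x y) (g : Og B) {d : ℕ} (hg : g ∈ Tset B d) :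
    ogMap e he g ∈ Tset B' d := by
  have ho := orderOf_injective _ (ogMap_injective e he) g
  refine ⟨ho ▸ hg.1, ?_⟩
  rw [ho, ← map_pow, eigd_ogMap]
  exact hg.2

theorem card_og_le {B : LinearMap.BilinForm F V} {B' : LinearMap.BilinForm F V'} [Finite V']
    (e : V ≃ₗ[F] V') (he : ∀ x y, B' (e x) (e y) = B x y) :
    Nat.card (Og B) ≤ Nat.card (Og B') :=
  Nat.card_le_card_of_injective _ (ogMap_injective e he)

theorem card_tset_le {B : LinearMap.BilinForm F V} {B' : LinearMap.BilinForm F V'} [Finite V']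
    (e : V ≃ₗ[F] V') (he : ∀ x y, B' (e x) (e y) = B x y) (d : ℕ) :
    Nat.card (Tset B d) ≤ Nat.card (Tset B' d) :=
  Nat.card_le_card_of_injective
    (fun g : Tset B d => (⟨ogMap e he g.1, ogMap_mem e he g.1 g.2⟩ : Tset B' d)) (by
      intro g g' h
      apply Subtype.ext
      exact ogMap_injective e he (congrArg Subtype.val h))

end

section

variable {F V : Type*} [Field F] [AddCommGroup V] [Module F V] {B : LinearMap.BilinForm F V}
variable {K : Type*} [Field K] [Algebra F K]

theorem decomp [FiniteDimensional F V] [FiniteDimensional F K] [Algebra.IsSeparable F K]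
    (h2 : (2 : F) ≠ 0) (hB : B.IsSymm) (hBn : B.Nondegenerate)
    (φ : K →ₗ[F] V) (hφ : Function.Injective φ) (hiso : ∀ x y, B (φ x) (φ y) = 0) :
    ∃ (W : Submodule F V) (e : ((K × K) × W) ≃ₗ[F] V),
      (∀ u v, B (e u) (e v) = bigForm K (B.restrict W) u v) ∧ (B.restrict W).Nondegenerate := by
  have hT : (Algebra.traceForm F K).IsSymm := Algebra.traceForm_isSymm F
  have hTn := traceForm_nondegenerate F K
  obtain ⟨ψ, h1, h3⟩ := exists_partner h2 hB hBn hT hTn φ hφ hiso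
  have hnd := hyp_nondeg hT hTn
  set H := hyp (Algebra.traceForm F K) with hH
  set j : K × K →ₗ[F] V := φ.coprod ψ with hj
  have hjj : ∀ p p', B (j p) (j p') = H p p' := by
    intro x y
    have : B (ψ x.2) (φ y.1) = Algebra.traceForm F K y.1 x.2 := by rw [← hB.eq]; exact h1 _ _
    simp [hj, hH, h1, h3, hiso, hyp_apply, this]
  let W : Submodule F V := LinearMap.ker (B.compl₂ j : V →ₗ[F] K × K →ₗ[F] F)
  have hW : ∀ (w : W) p, B w (j p) = 0 := by
    intro w p
    exact LinearMap.congr_fun (LinearMap.mem_ker.1 w.2) p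
  have hW' : ∀ (w : W) p, B (j p) w = 0 := by
    intro w p
    rw [hB.eq]; exact hW w p
  let Θ : (K × K) × W →ₗ[F] V := j.coprod W.subtype
  have hΘ : ∀ u, Θ u = j u.1 + u.2 := fun u => by simp [Θ]
  have hiso : ∀ u v, B (Θ u) (Θ v) = bigForm K (B.restrict W) u v := by
    intro u v
    rw [hΘ, hΘ]
    simp only [map_add, LinearMap.add_apply, hjj, hW, hW', zero_add, add_zero]
    rfl
  have hsurj : Function.Surjective Θ := by
    intro v
    let p0 := (H.toDual hnd).symm ((B v) ∘ₗ j)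
    have hp0 : ∀ p, H p0 p = B v (j p) := by
      intro p
      rw [← LinearMap.BilinForm.toDual_def (B := H) hnd, LinearEquiv.apply_symm_apply]
      rfl
    refine ⟨(p0, ⟨v - j p0, ?_⟩), ?_⟩
    · rw [LinearMap.mem_ker]
      apply LinearMap.ext
      intro p
      change B (v - j p0) (j p) = 0
      rw [map_sub, LinearMap.sub_apply, hjj, hp0, sub_self]
    · rw [hΘ]; simp
  have hinj : Function.Injective Θ := by
    rw [← LinearMap.ker_eq_bot, LinearMap.ker_eq_bot']
    rintro ⟨p, w⟩ h
    rw [hΘ] at h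
    simp only at h
    have hp : p = 0 := by
      apply hnd.2
      intro p'
      have := congrArg (B (j p')) h
      rwa [map_add, hW', add_zero, hjj, map_zero] at this
    rw [hp, map_zero, zero_add] at h
    rw [hp]
    exact Prod.ext rfl (Subtype.ext h)
  have key : ∀ w : W, (∀ w' : W, B w w' = 0) → w = 0 := by
    intro w hw
    apply Subtype.ext
    apply hBn.1
    intro v
    obtain ⟨u, rfl⟩ := hsurj v
    rw [hΘ, map_add, hW, hw, add_zero]
  refine ⟨W, LinearEquiv.ofBijective Θ ⟨hinj, hsurj⟩, hiso, ?_, ?_⟩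
  · intro w hw; exact key w hw
  · intro w hw
    apply key w
    intro w'
    rw [hB.eq]
    exact hw w'

end

section

variable {F W : Type*} [Field F] [AddCommGroup W] [Module F W]
variable {K : Type*} [Field K] [Algebra F K] [Finite F] [Finite K] [Finite W]

theorem card_big_le {q b s : ℕ} (h2 : (2 : F) ≠ 0) (hq : q = Nat.card F) (hq3 : 3 ≤ q)
    (h : Arith q b s) {C : LinearMap.BilinForm F W} (hC : C.IsSymm) (hCn : C.Nondegenerate)
    (hm : 2 ^ b ∣ finrank F K) {l : ℕ} (hl : finrank F W ≤ 2 * l + 1)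
    (hlb : Real.log l + 1 ≤ 2 ^ b) :
    (Nat.card (Og (bigForm K C)) : ℝ) ≤
      12 * finrank F K * Nat.card (Tset (bigForm K C) (2 * finrank F K)) := by
  have : FiniteDimensional F K := Module.Finite.of_finite
  have : FiniteDimensional F W := Module.Finite.of_finite
  have hf := fibre_bound (K := K) h2 hq h C
  have hΛ := card_Lam_ge (K := K) hq h hq3 hm
  have hb := card_bad_le h2 hC hCn hq h hl hlb
  have hsum : Nat.card {g : Og C // 2 ^ s ∣ orderOf g} +
      Nat.card {g : Og C // ¬ 2 ^ s ∣ orderOf g} = Nat.card (Og C) := by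
    classical
    have := Fintype.ofFinite (Og C)
    rw [Nat.card_eq_fintype_card, Nat.card_eq_fintype_card, Nat.card_eq_fintype_card]
    have := Fintype.card_subtype_compl (fun g : Og C => 2 ^ s ∣ orderOf g)
    have h3 := Fintype.card_subtype_le (fun g : Og C => 2 ^ s ∣ orderOf g)
    omega
  have hf' : (Nat.card (Og (bigForm K C)) : ℝ) * (Nat.card (Lam F K s) *
      Nat.card {g : Og C // ¬ 2 ^ s ∣ orderOf g}) ≤
    Nat.card (Tset (bigForm K C) (2 * finrank F K)) *
      (2 * (finrank F K * (Nat.card Kˣ * Nat.card (Og C)))) := by exact_mod_cast hf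
  have hΛ' : (Nat.card Kˣ : ℝ) ≤ 3 * Nat.card (Lam F K s) := by exact_mod_cast hΛ
  have hs' : (Nat.card {g : Og C // 2 ^ s ∣ orderOf g} : ℝ) +
      Nat.card {g : Og C // ¬ 2 ^ s ∣ orderOf g} = Nat.card (Og C) := by exact_mod_cast hsum
  have hKpos : (0 : ℝ) < Nat.card Kˣ := by exact_mod_cast Nat.card_pos
  have hCpos : (0 : ℝ) < Nat.card (Og C) := by exact_mod_cast Nat.card_pos
  set O := (Nat.card (Og (bigForm K C)) : ℝ)
  set Λ := (Nat.card (Lam F K s) : ℝ)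
  set G := (Nat.card {g : Og C // ¬ 2 ^ s ∣ orderOf g} : ℝ)
  set T := (Nat.card (Tset (bigForm K C) (2 * finrank F K)) : ℝ)
  set u := (Nat.card Kˣ : ℝ)
  set c := (Nat.card (Og C) : ℝ)
  set m := (finrank F K : ℝ)
  have hO : 0 ≤ O := Nat.cast_nonneg _
  have hG : c / 2 ≤ G := by linarith
  have h5 : (u / 3) * (c / 2) ≤ Λ * G := by
    apply mul_le_mul (by linarith) hG (by positivity) (by linarith)
  have h6 : O * ((u / 3) * (c / 2)) ≤ T * (2 * (m * (u * c))) :=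
    (mul_le_mul_of_nonneg_left h5 hO).trans hf'
  have h7 : O * (u * c) ≤ (12 * m * T) * (u * c) := by nlinarith
  exact le_of_mul_le_mul_right h7 (by positivity)

end

/-- The dot product form. -/
def dotF (F : Type*) [Field F] (n : ℕ) : LinearMap.BilinForm F (Fin n → F) :=
  LinearMap.mk₂ F (fun u v => u ⬝ᵥ v) (by intros; simp [add_dotProduct]) (by intros; simp)
    (by intros; simp) (by intros; simp)

section

variable {F : Type*} [Field F]

theorem dotF_apply {n : ℕ} (u v : Fin n → F) : dotF F n u v = u ⬝ᵥ v := rfl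

theorem dotF_symm (n : ℕ) : (dotF F n).IsSymm :=
  LinearMap.BilinForm.isSymm_iff.2 ⟨fun x y => dotProduct_comm x y⟩

theorem dotF_nondeg (n : ℕ) : (dotF F n).Nondegenerate := by
  constructor
  · intro x h
    ext i
    have := h (Pi.single i 1)
    simpa [dotF_apply] using this
  · intro x h
    ext i
    have := h (Pi.single i 1)
    simpa [dotF_apply] using this

theorem exists_isotropic [Finite F] (hodd : Odd (Nat.card F)) {K : Type*} [AddCommGroup K] [Module F K]
    [FiniteDimensional F K] {n r : ℕ} (hr : finrank F K = 2 * r) (hn : 4 * r ≤ n) :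
    ∃ φ : K →ₗ[F] (Fin n → F), Function.Injective φ ∧ ∀ x y, dotF F n (φ x) (φ y) = 0 := by
  obtain ⟨x, y, hxy⟩ : ∃ x y : F, x ^ 2 + y ^ 2 = -1 := by
    have := Fintype.ofFinite F
    obtain ⟨x, y, h⟩ := FiniteField.exists_root_sum_quadratic (R := F)
      (f := X ^ 2) (g := X ^ 2 - C (-1)) (degree_X_pow 2) (degree_X_pow_sub_C (by decide) _) (by
        rw [← Nat.card_eq_fintype_card]
        exact Nat.odd_iff.1 hodd)
    refine ⟨x, y, ?_⟩
    simp at h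
    linear_combination h
  have e0 : finrank F K = finrank F (Fin r → F × F) := by
    rw [hr, finrank_pi_fintype]; simp; ring
  let e := LinearEquiv.ofFinrankEq K (Fin r → F × F) e0
  let f : Fin r × Fin 4 → Fin n := fun i => Fin.castLE (by omega) (finProdFinEquiv i)
  have hf : Function.Injective f := by
    intro i j h
    exact finProdFinEquiv.injective (Fin.castLE_injective _ h)
  let φ0 : (Fin r → F × F) →ₗ[F] (Fin r × Fin 4 → F) :=
    { toFun := fun p i => ![x * (p i.1).1 - y * (p i.1).2, y * (p i.1).1 + x * (p i.1).2,
        (p i.1).1, (p i.1).2] i.2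
      map_add' := by
        intro p p'
        ext ⟨i, j⟩
        fin_cases j <;> simp <;> ring
      map_smul' := by
        intro c p
        ext ⟨i, j⟩
        fin_cases j <;> simp <;> ring }
  have h0inj : Function.Injective φ0 := by
    intro p p' h
    ext i
    · exact congrFun h (i, 2)
    · exact congrFun h (i, 3)
  refine ⟨Function.ExtendByZero.linearMap F f ∘ₗ φ0 ∘ₗ e, ?_, ?_⟩
  · have : Function.Injective (Function.ExtendByZero.linearMap F f) := by
      intro v w h
      ext i
      have := congrFun h (f i)
      simpa [hf.extend_apply] using this
    exact this.comp (h0inj.comp e.injective)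
  · intro a b
    rw [dotF_apply]
    have : ∀ p p', Function.extend f (φ0 p) 0 ⬝ᵥ Function.extend f (φ0 p') 0 = 0 := by
      intro p p'
      unfold dotProduct
      rw [← Fintype.sum_of_injective f hf (fun i => φ0 p i * φ0 p' i) _ (by
        intro i hi
        rw [Function.extend_apply' _ _ _ (by simpa using hi)]; simp) (by
        intro i; simp [hf.extend_apply])]
      rw [Fintype.sum_prod_type]
      apply Finset.sum_eq_zero
      intro i _
      rw [Fin.sum_univ_four]
      simp only [φ0, LinearMap.coe_mk, AddHom.coe_mk]
      simp
      linear_combination ((p i).1 * (p' i).1 + (p i).2 * (p' i).2) * hxy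
    exact this _ _

theorem card_T_dot [Finite F] {q b s : ℕ} (h2 : (2 : F) ≠ 0) (hq : q = Nat.card F) (hq3 : 3 ≤ q)
    (h : Arith q b s) {m l n : ℕ} (hm : 2 ^ b ∣ m) (hm0 : 0 < m) (hml : m ≤ l)
    (hn : n = 2 * l + 1) (hlb : Real.log l + 1 ≤ 2 ^ b) :
    (Nat.card (Og (dotF F n)) : ℝ) ≤ 12 * m * Nat.card (Tset (dotF F n) (2 * m)) := by
  obtain ⟨p, hp⟩ := CharP.exists F
  have : Fact p.Prime := ⟨CharP.char_is_prime F p⟩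
  have : NeZero m := ⟨hm0.ne'⟩
  let K := FiniteField.Extension F p m
  have : Finite K := Module.finite_of_finite F
  have hfr : finrank F K = m := FiniteField.finrank_extension F p m
  obtain ⟨r, hr⟩ : ∃ r, m = 2 * r := by
    have : 2 ∣ m := (dvd_pow_self 2 (by have := h.two_le; omega)).trans hm
    exact this
  obtain ⟨φ, hφ, hiso⟩ := exists_isotropic (F := F) (K := K) (n := n) (hq ▸ h.odd)
    (hfr.trans hr) (by omega)
  obtain ⟨W, e, he, hWn⟩ := decomp h2 (dotF_symm n) (dotF_nondeg n) φ hφ hiso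
  have hWs : ((dotF F n).restrict W).IsSymm :=
    LinearMap.BilinForm.isSymm_iff.2 ⟨fun x y => dotProduct_comm (x : Fin n → F) y⟩
  have hWd : finrank F W ≤ 2 * l + 1 := by
    have := Submodule.finrank_le W
    rw [finrank_fin_fun] at this
    omega
  have key := card_big_le (K := K) h2 hq hq3 h hWs hWn (hfr.symm ▸ hm) hWd hlb
  rw [hfr] at key
  have he' : ∀ x y, bigForm K ((dotF F n).restrict W) (e.symm x) (e.symm y) = dotF F n x y := by
    intro x y
    rw [← he, e.apply_symm_apply, e.apply_symm_apply]
  have c1 : (Nat.card (Og (dotF F n)) : ℝ) ≤ Nat.card (Og (bigForm K ((dotF F n).restrict W))) := by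
    exact_mod_cast card_og_le e.symm he'
  have c2 : (Nat.card (Tset (bigForm K ((dotF F n).restrict W)) (2 * m)) : ℝ) ≤
      Nat.card (Tset (dotF F n) (2 * m)) := by
    exact_mod_cast card_tset_le e he _
  calc _ ≤ _ := c1
    _ ≤ _ := key
    _ ≤ _ := by gcongr

/-- All elements of interest. -/
def Uset {V : Type*} [AddCommGroup V] [Module F V] (B : LinearMap.BilinForm F V) (k : ℕ) :
    Set (Og B) :=
  {h | 4 ∣ orderOf h ∧ eigd ((h ^ (orderOf h / 2) : Og B) : V ≃ₗ[F] V) ≤ 2 * k}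

theorem card_U_dot [Finite F] {q b s : ℕ} (h2 : (2 : F) ≠ 0) (hq : q = Nat.card F) (hq3 : 3 ≤ q)
    (h : Arith q b s) {k l n N : ℕ} (hN : 2 ^ b * N ≤ k) (hkl : k ≤ l)
    (hn : n = 2 * l + 1) (hlb : Real.log l + 1 ≤ 2 ^ b) :
    (Nat.card (Og (dotF F n)) : ℝ) * (harmonic N : ℚ) ≤
      12 * 2 ^ b * Nat.card (Uset (dotF F n) k) := by
  classical
  have := Fintype.ofFinite (Og (dotF F n))
  have hU : ∑ j ∈ Finset.range N, Nat.card (Tset (dotF F n) (2 * (2 ^ b * (j + 1)))) ≤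
      Nat.card (Uset (dotF F n) k) := by
    simp only [Nat.card_eq_card_toFinset]
    rw [← Finset.card_biUnion]
    · apply Finset.card_le_card
      intro g hg
      simp only [Finset.mem_biUnion, Finset.mem_range, Set.mem_toFinset] at hg ⊢
      obtain ⟨j, hj, hg1, hg2⟩ := hg
      refine ⟨hg1, hg2.le.trans ?_⟩
      have : 2 ^ b * (j + 1) ≤ 2 ^ b * N := Nat.mul_le_mul_left _ (by omega)
      omega
    · intro i _ j _ hij
      rw [Function.onFun, Finset.disjoint_left]
      intro g hg hg'
      simp only [Set.mem_toFinset] at hg hg'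
      have := hg.2.symm.trans hg'.2
      apply hij
      have h3 : 2 ^ b * (i + 1) = 2 ^ b * (j + 1) := by omega
      have := Nat.eq_of_mul_eq_mul_left (by positivity) h3
      omega
  have hU' : ∑ j ∈ Finset.range N, (Nat.card (Tset (dotF F n) (2 * (2 ^ b * (j + 1)))) : ℝ) ≤
      Nat.card (Uset (dotF F n) k) := by exact_mod_cast hU
  calc (Nat.card (Og (dotF F n)) : ℝ) * (harmonic N : ℚ)
      = ∑ j ∈ Finset.range N, (Nat.card (Og (dotF F n)) : ℝ) * ((j : ℝ) + 1)⁻¹ := by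
        rw [harmonic]; push_cast; rw [Finset.mul_sum]
    _ ≤ ∑ j ∈ Finset.range N,
        12 * 2 ^ b * (Nat.card (Tset (dotF F n) (2 * (2 ^ b * (j + 1)))) : ℝ) := by
        apply Finset.sum_le_sum
        intro j hj
        rw [Finset.mem_range] at hj
        have hle : 2 ^ b * (j + 1) ≤ 2 ^ b * N := Nat.mul_le_mul_left _ (by omega)
        have := card_T_dot h2 hq hq3 h (m := 2 ^ b * (j + 1)) (Dvd.intro _ rfl) (by positivity)
          (by omega) hn hlb
        rw [← div_eq_mul_inv, div_le_iff₀ (by positivity)]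
        push_cast at this
        linarith
    _ ≤ _ := by rw [← Finset.mul_sum]; gcongr

end

end OrthCount

namespace OrthCount

open Module Polynomial

section

variable {F : Type*} [Field F] {n : ℕ}

/-- Matrices as linear equivalences. -/
noncomputable def matE (F : Type*) [Field F] (n : ℕ) :
    GL (Fin n) F ≃* ((Fin n → F) ≃ₗ[F] (Fin n → F)) :=
  Matrix.GeneralLinearGroup.toLin.trans
    (LinearMap.GeneralLinearGroup.generalLinearEquiv F (Fin n → F))

theorem matE_coe (h : GL (Fin n) F) : ((matE F n h : (Fin n → F) ≃ₗ[F] (Fin n → F)) :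
    (Fin n → F) →ₗ[F] (Fin n → F)) = Matrix.toLin' (h : Matrix (Fin n) (Fin n) F) := rfl

theorem matE_apply (h : GL (Fin n) F) (v : Fin n → F) :
    matE F n h v = (h : Matrix (Fin n) (Fin n) F) *ᵥ v := rfl

theorem negOneEigDim_eq (h : GL (Fin n) F) :
    negOneEigDim F (h : Matrix (Fin n) (Fin n) F) = eigd (matE F n h) := by
  unfold negOneEigDim eigd
  rw [matE_coe, map_add, Matrix.toLin'_one]
  rfl

theorem matE_mem (h : GL (Fin n) F) :
    matE F n h ∈ Og (dotF F n) ↔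
      (h : Matrix (Fin n) (Fin n) F)ᵀ * (h : Matrix (Fin n) (Fin n) F) = 1 := by
  have e : ∀ x y, dotF F n (matE F n h x) (matE F n h y) =
      x ⬝ᵥ ((h : Matrix (Fin n) (Fin n) F)ᵀ * (h : Matrix (Fin n) (Fin n) F)) *ᵥ y := by
    intro x y
    rw [dotF_apply, matE_apply, matE_apply, ← Matrix.mulVec_mulVec, Matrix.dotProduct_mulVec x,
      Matrix.vecMul_transpose]
  constructor
  · intro hh
    ext i j
    have := hh (Pi.single i 1) (Pi.single j 1)
    rw [e] at this
    simpa [dotF_apply, Matrix.one_apply, Pi.single_apply, eq_comm] using this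
  · intro hh x y
    rw [e, hh, Matrix.one_mulVec]
    rfl

/-- The relevant property, for matrices. -/
def PropU (k : ℕ) (h : GL (Fin n) F) : Prop :=
  4 ∣ orderOf h ∧
    negOneEigDim F ((h ^ (orderOf h / 2) : GL (Fin n) F) : Matrix (Fin n) (Fin n) F) ≤ 2 * k

theorem PropU.neg [Finite F] {k : ℕ} {h : GL (Fin n) F} (hh : PropU k h) : PropU k (-h) := by
  obtain ⟨h4, hd⟩ := hh
  have ho : orderOf (-h) = orderOf h := by
    apply Nat.dvd_antisymm
    · apply orderOf_dvd_of_pow_eq_one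
      rw [Even.neg_pow (even_iff_two_dvd.2 (dvd_trans (by norm_num) h4)), pow_orderOf_eq_one]
    · have h1 : h ^ (2 * orderOf (-h)) = 1 := by
        rw [← Even.neg_pow (even_two_mul _), mul_comm, pow_mul, pow_orderOf_eq_one, one_pow]
      have h2 := h4.trans (orderOf_dvd_of_pow_eq_one h1)
      have h3 : 2 ∣ orderOf (-h) := by omega
      apply orderOf_dvd_of_pow_eq_one
      rw [← Even.neg_pow (even_iff_two_dvd.2 h3), pow_orderOf_eq_one]
  refine ⟨ho ▸ h4, ?_⟩
  rw [ho, Even.neg_pow]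
  · exact hd
  · rw [even_iff_two_dvd]; omega

theorem PropU_iff {k : ℕ} (g : Og (dotF F n)) :
    g ∈ Uset (dotF F n) k ↔ PropU k ((matE F n).symm g) := by
  have ho : orderOf ((matE F n).symm g) = orderOf g := by
    rw [MulEquiv.orderOf_eq, Subgroup.orderOf_coe]
  unfold PropU
  rw [ho, negOneEigDim_eq, map_pow, MulEquiv.apply_symm_apply]
  rfl

/-- The matrices in question. -/
def Aset (F : Type*) [Field F] (n k : ℕ) : Set (GL (Fin n) F) :=
  {h | ((h : Matrix (Fin n) (Fin n) F)ᵀ * (h : Matrix (Fin n) (Fin n) F) = 1 ∧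
          (h : Matrix (Fin n) (Fin n) F).det = 1) ∧ PropU k h}

/-- The special orthogonal group. -/
def SOset (F : Type*) [Field F] (n : ℕ) : Set (GL (Fin n) F) :=
  {h | (h : Matrix (Fin n) (Fin n) F)ᵀ * (h : Matrix (Fin n) (Fin n) F) = 1 ∧
          (h : Matrix (Fin n) (Fin n) F).det = 1}

theorem det_neg_gl (hn : Odd n) (h : GL (Fin n) F) :
    ((-h : GL (Fin n) F) : Matrix (Fin n) (Fin n) F).det =
      - (h : Matrix (Fin n) (Fin n) F).det := by
  rw [Units.val_neg, Matrix.det_neg, Fintype.card_fin, hn.neg_one_pow]; ring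

theorem neg_orth (h : GL (Fin n) F)
    (hh : (h : Matrix (Fin n) (Fin n) F)ᵀ * (h : Matrix (Fin n) (Fin n) F) = 1) :
    ((-h : GL (Fin n) F) : Matrix (Fin n) (Fin n) F)ᵀ *
      ((-h : GL (Fin n) F) : Matrix (Fin n) (Fin n) F) = 1 := by
  rw [Units.val_neg, Matrix.transpose_neg, neg_mul_neg, hh]

theorem det_orth (h : GL (Fin n) F)
    (hh : (h : Matrix (Fin n) (Fin n) F)ᵀ * (h : Matrix (Fin n) (Fin n) F) = 1) :
    (h : Matrix (Fin n) (Fin n) F).det = 1 ∨ (h : Matrix (Fin n) (Fin n) F).det = -1 := by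
  have := congrArg Matrix.det hh
  rw [Matrix.det_mul, Matrix.det_transpose, Matrix.det_one] at this
  exact mul_self_eq_one_iff.1 this

theorem card_U_le [Finite F] (hn : Odd n) (k : ℕ) :
    Nat.card (Uset (dotF F n) k) ≤ 2 * Nat.card (Aset F n k) := by
  classical
  have e : 2 * Nat.card (Aset F n k) = Nat.card (Bool × Aset F n k) := by simp
  rw [e]
  have ex : ∀ g : Uset (dotF F n) k, ∃ p : Bool × Aset F n k,
      ((matE F n).symm (g : Og (dotF F n)) : GL (Fin n) F) = if p.1 then p.2.1 else -p.2.1 := by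
    intro g
    have hg := (PropU_iff _).1 g.2
    have ho := (matE_mem ((matE F n).symm (g : Og (dotF F n)))).1 (by
      rw [MulEquiv.apply_symm_apply]; exact g.1.2)
    rcases det_orth _ ho with hd | hd
    · exact ⟨(true, ⟨_, ⟨ho, hd⟩, hg⟩), by simp⟩
    · refine ⟨(false, ⟨-_, ⟨neg_orth _ ho, ?_⟩, hg.neg⟩), by simp⟩
      rw [det_neg_gl hn, hd, neg_neg]
  choose f hf using ex
  apply Nat.card_le_card_of_injective f
  intro g g' h
  have h1 := hf g
  rw [h, ← hf g'] at h1
  exact Subtype.ext (Subtype.ext ((matE F n).symm.injective h1))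

theorem card_SO_le [Finite F] (h2 : (2 : F) ≠ 0) (hn : Odd n) :
    2 * Nat.card (SOset F n) ≤ Nat.card (Og (dotF F n)) := by
  have e : 2 * Nat.card (SOset F n) = Nat.card (Bool × SOset F n) := by simp
  rw [e]
  have hmem : ∀ p : Bool × SOset F n, matE F n (if p.1 then p.2.1 else -p.2.1) ∈
      Og (dotF F n) := by
    rintro ⟨b, h⟩
    rw [matE_mem]
    cases b
    · simpa using neg_orth _ h.2.1
    · simpa using h.2.1
  apply Nat.card_le_card_of_injective (fun p => (⟨_, hmem p⟩ : Og (dotF F n)))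
  have hne : (1 : F) ≠ -1 := by
    intro h
    apply h2
    linear_combination h
  rintro ⟨b, h⟩ ⟨b', h'⟩ hh
  have h1 := (matE F n).injective (congrArg Subtype.val hh)
  have hd := h.2.2
  have hd' := h'.2.2
  have h3 := congrArg (fun m : GL (Fin n) F => (m : Matrix (Fin n) (Fin n) F).det) h1
  cases b <;> cases b'
  · simp only [Bool.false_eq_true, if_false, neg_inj] at h1
    rw [Subtype.ext h1]
  · simp only [Bool.false_eq_true, if_false, if_true] at h3
    rw [det_neg_gl hn, hd, hd'] at h3
    exact absurd h3.symm hne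
  · simp only [Bool.false_eq_true, if_false, if_true] at h3
    rw [det_neg_gl hn, hd, hd'] at h3
    exact absurd h3 hne
  · simp only [if_true] at h1
    rw [Subtype.ext h1]

end

/-- The numerical choices. -/
theorem numerics (ε : ℝ) (hε : ε ∈ Set.Ioo (0 : ℝ) 1) (ℓ : ℕ)
    (h1 : ⌈(Real.log ℓ + 1) ^ 2⌉ < ⌈(ℓ : ℝ) ^ ε⌉)
    (h2 : ⌈(ℓ : ℝ) ^ ε⌉ ≤ (ℓ : ℤ) - 2 * ⌈Real.log ℓ⌉) :
    ∃ k b N : ℕ, (k : ℤ) = ⌈(ℓ : ℝ) ^ ε⌉ ∧ k ≤ ℓ ∧ 2 ≤ b ∧ Real.log ℓ + 1 ≤ 2 ^ b ∧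
      2 ^ b * N ≤ k ∧ ε * 2 ^ b < 16 * (harmonic N : ℚ) := by
  obtain ⟨hε0, hε1⟩ := hε
  have hlog0 : 0 ≤ Real.log ℓ := Real.log_natCast_nonneg ℓ
  have hk0 : 0 ≤ ⌈(ℓ : ℝ) ^ ε⌉ := Int.ceil_nonneg (by positivity)
  obtain ⟨k, hk⟩ := Int.eq_ofNat_of_zero_le hk0
  have hkl : k ≤ ℓ := by
    have : 0 ≤ ⌈Real.log ℓ⌉ := Int.ceil_nonneg hlog0
    omega
  have hkL : (Real.log ℓ + 1) ^ 2 < k := by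
    have := Int.le_ceil ((Real.log ℓ + 1) ^ 2)
    rw [hk] at h1
    have h3 : ((⌈(Real.log ℓ + 1) ^ 2⌉ : ℤ) : ℝ) < (k : ℝ) := by exact_mod_cast h1
    linarith
  have hpow : (ℓ : ℝ) ^ ε ≤ k := by
    have := Int.le_ceil ((ℓ : ℝ) ^ ε)
    rw [hk] at this
    exact_mod_cast this
  have hk2 : 2 ≤ k := by
    have : (1 : ℝ) < k := by nlinarith
    exact_mod_cast this
  have hl2 : (2 : ℝ) ≤ ℓ := by exact_mod_cast hk2.trans hkl
  have hlog2 := Real.log_two_gt_d9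
  have hk3 : 3 ≤ k := by
    have : Real.log 2 ≤ Real.log ℓ := Real.log_le_log (by norm_num) hl2
    have : (2 : ℝ) < k := by nlinarith
    exact_mod_cast this
  have hlog3 : 1 < Real.log 3 := by
    rw [Real.lt_log_iff_exp_lt (by norm_num)]
    have := Real.exp_one_lt_d9
    linarith
  have hk3' : (3 : ℝ) ≤ k := by exact_mod_cast hk3
  have hl3 : (3 : ℝ) ≤ ℓ := by exact_mod_cast hk3.trans hkl
  have hlogl : 1 < Real.log ℓ := hlog3.trans_le (Real.log_le_log (by norm_num) hl3)
  have hlogk : 1 < Real.log k := hlog3.trans_le (Real.log_le_log (by norm_num) hk3')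
  set L := Real.log ℓ + 1 with hL
  obtain ⟨c, hc1, hc2⟩ := exists_nat_pow_near (x := L) (y := 2) (by linarith) (by norm_num)
  have hb2 : 2 ≤ c + 1 := by
    by_contra h
    have : c = 0 := by omega
    rw [this] at hc2
    norm_num at hc2
    linarith
  have h2b : (2 : ℝ) ^ (c + 1) ≤ 2 * L := by rw [pow_succ]; linarith
  refine ⟨k, c + 1, k / 2 ^ (c + 1), hk.symm, hkl, hb2, hc2.le, Nat.mul_div_le _ _, ?_⟩
  set N := k / 2 ^ (c + 1) with hN
  have hN1 : 1 ≤ N := by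
    rw [hN, Nat.one_le_div_iff (by positivity)]
    have : (2 : ℝ) ^ (c + 1) ≤ k := by nlinarith
    exact_mod_cast this
  have hNk : (k : ℝ) < 2 ^ (c + 1) * (N + 1) := by
    have := Nat.lt_mul_div_succ k (show 0 < 2 ^ (c + 1) by positivity)
    exact_mod_cast this
  have hH := log_add_one_le_harmonic N
  push_cast at hH
  set H := ((harmonic N : ℚ) : ℝ)
  have hH2 : Real.log 2 ≤ H := by
    refine le_trans (Real.log_le_log (by norm_num) ?_) hH
    have : (1 : ℝ) ≤ N := by exact_mod_cast hN1
    linarith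
  have hp : (0 : ℝ) < 2 ^ (c + 1) := by positivity
  have e1 : Real.log k ≤ Real.log (2 ^ (c + 1)) + Real.log (N + 1) := by
    rw [← Real.log_mul hp.ne' (by positivity)]
    exact Real.log_le_log (by linarith) hNk.le
  have e2 : 2 * Real.log (2 ^ (c + 1)) ≤ 2 * Real.log 2 + Real.log k := by
    have e3 : 2 * Real.log (2 ^ (c + 1)) = Real.log ((2 ^ (c + 1)) ^ 2) := by
      rw [Real.log_pow]; norm_num
    have e4 : 2 * Real.log 2 + Real.log k = Real.log (2 ^ 2 * k) := by
      rw [Real.log_mul (by norm_num) (by linarith), Real.log_pow]; norm_num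
    rw [e3, e4]
    apply Real.log_le_log (by positivity)
    nlinarith
  have e5 : ε * Real.log ℓ ≤ Real.log k := by
    rw [← Real.log_rpow (by linarith)]
    exact Real.log_le_log (by positivity) hpow
  have e6 : ε * 2 ^ (c + 1) ≤ ε * (2 * L) := mul_le_mul_of_nonneg_left h2b hε0.le
  have e7 : ε * (2 * L) = 2 * (ε * Real.log ℓ) + 2 * ε := by rw [hL]; ring
  linarith

end OrthCount

theorem stmt14 (ε : ℝ) (hε : ε ∈ Set.Ioo (0 : ℝ) 1) (ℓ : ℕ)
    (h1 : ⌈(Real.log ℓ + 1) ^ 2⌉ < ⌈(ℓ : ℝ) ^ ε⌉)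
    (h2 : ⌈(ℓ : ℝ) ^ ε⌉ ≤ (ℓ : ℤ) - 2 * ⌈Real.log ℓ⌉)
    (F : Type*) [Field F] [Fintype F] (hF : Odd (Fintype.card F))
    (n : ℕ) (hn : n = 2 * ℓ + 1) :
    (Nat.card {h : GL (Fin n) F //
        ((h : Matrix (Fin n) (Fin n) F)ᵀ * (h : Matrix (Fin n) (Fin n) F) = 1 ∧
          (h : Matrix (Fin n) (Fin n) F).det = 1) ∧
        Even (orderOf h) ∧ orderOf (h ^ (orderOf h / 2)) = 2 ∧
        ((negOneEigDim F ((h ^ (orderOf h / 2) : GL (Fin n) F) :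
            Matrix (Fin n) (Fin n) F) : ℤ) ≤ 2 * ⌈(ℓ : ℝ) ^ ε⌉)} : ℝ) /
      Nat.card {h : GL (Fin n) F //
        (h : Matrix (Fin n) (Fin n) F)ᵀ * (h : Matrix (Fin n) (Fin n) F) = 1 ∧
          (h : Matrix (Fin n) (Fin n) F).det = 1} >
      ε / 192 := by
  obtain ⟨k, b, N, hk, hkl, hb, hlb, hNk, hnum⟩ := OrthCount.numerics ε hε ℓ h1 h2
  have hodd : Odd (Nat.card F) := by rw [Nat.card_eq_fintype_card]; exact hF
  have h20 : (2 : F) ≠ 0 := by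
    apply Ring.two_ne_zero
    intro h
    have := FiniteField.even_card_of_char_two h
    rw [Nat.odd_iff] at hF
    omega
  have hq3 : 3 ≤ Nat.card F := by
    have : 1 < Nat.card F := Finite.one_lt_card
    obtain ⟨c, hc⟩ := hodd
    omega
  obtain ⟨s, hs⟩ := OrthCount.Arith.exists hodd hq3 hb
  have hU := OrthCount.card_U_dot h20 rfl hq3 hs hNk hkl hn hlb
  have hno : Odd n := ⟨ℓ, hn⟩
  have hUA := OrthCount.card_U_le (F := F) hno k
  have hSO := OrthCount.card_SO_le h20 hno
  set A := Nat.card {h : GL (Fin n) F //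
        ((h : Matrix (Fin n) (Fin n) F)ᵀ * (h : Matrix (Fin n) (Fin n) F) = 1 ∧
          (h : Matrix (Fin n) (Fin n) F).det = 1) ∧
        Even (orderOf h) ∧ orderOf (h ^ (orderOf h / 2)) = 2 ∧
        ((negOneEigDim F ((h ^ (orderOf h / 2) : GL (Fin n) F) :
            Matrix (Fin n) (Fin n) F) : ℤ) ≤ 2 * ⌈(ℓ : ℝ) ^ ε⌉)} with hA
  have hD : Nat.card {h : GL (Fin n) F //
        (h : Matrix (Fin n) (Fin n) F)ᵀ * (h : Matrix (Fin n) (Fin n) F) = 1 ∧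
          (h : Matrix (Fin n) (Fin n) F).det = 1} = Nat.card (OrthCount.SOset F n) := rfl
  rw [hD]
  have hAA : Nat.card (OrthCount.Aset F n k) ≤ A := by
    apply Nat.card_le_card_of_injective (fun h : OrthCount.Aset F n k =>
      (⟨h.1, h.2.1, even_iff_two_dvd.2 (dvd_trans (by norm_num) h.2.2.1), by
        have h4 := h.2.2.1
        have hpos := orderOf_pos h.1
        have hdv : orderOf h.1 / 2 ∣ orderOf h.1 :=
          Nat.div_dvd_of_dvd (dvd_trans (by norm_num) h4)
        rw [orderOf_pow_of_dvd (by omega) hdv]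
        exact Nat.div_div_self (dvd_trans (by norm_num) h4) hpos.ne', by
        rw [← hk]
        exact_mod_cast h.2.2.2⟩ : {h : GL (Fin n) F //
        ((h : Matrix (Fin n) (Fin n) F)ᵀ * (h : Matrix (Fin n) (Fin n) F) = 1 ∧
          (h : Matrix (Fin n) (Fin n) F).det = 1) ∧
        Even (orderOf h) ∧ orderOf (h ^ (orderOf h / 2)) = 2 ∧
        ((negOneEigDim F ((h ^ (orderOf h / 2) : GL (Fin n) F) :
            Matrix (Fin n) (Fin n) F) : ℤ) ≤ 2 * ⌈(ℓ : ℝ) ^ ε⌉)}))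
    intro x y hxy
    exact Subtype.ext (Subtype.mk.inj hxy)
  have hDpos : 0 < Nat.card (OrthCount.SOset F n) := by
    have : Nonempty (OrthCount.SOset F n) := ⟨⟨1, by simp, by simp⟩⟩
    exact Nat.card_pos
  have hUA' : (Nat.card (OrthCount.Uset (OrthCount.dotF F n) k) : ℝ) ≤
      2 * Nat.card (OrthCount.Aset F n k) := by exact_mod_cast hUA
  have hSO' : 2 * (Nat.card (OrthCount.SOset F n) : ℝ) ≤
      Nat.card (OrthCount.Og (OrthCount.dotF F n)) := by exact_mod_cast hSO
  have hAA' : (Nat.card (OrthCount.Aset F n k) : ℝ) ≤ A := by exact_mod_cast hAA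
  have hDpos' : (0 : ℝ) < Nat.card (OrthCount.SOset F n) := by exact_mod_cast hDpos
  rw [gt_iff_lt, lt_div_iff₀ hDpos']
  have hpb : (0 : ℝ) < 2 ^ b := by positivity
  have hHpos : (0 : ℝ) < (harmonic N : ℚ) := by
    have := mul_pos hε.1 hpb
    linarith
  set D := (Nat.card (OrthCount.SOset F n) : ℝ)
  set O := (Nat.card (OrthCount.Og (OrthCount.dotF F n)) : ℝ)
  set H := ((harmonic N : ℚ) : ℝ)
  have k1 : 2 * D * H ≤ O * H := mul_le_mul_of_nonneg_right hSO' hHpos.le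
  have k2 : 12 * 2 ^ b * (Nat.card (OrthCount.Uset (OrthCount.dotF F n) k) : ℝ) ≤
      12 * 2 ^ b * (2 * A) := by
    apply mul_le_mul_of_nonneg_left _ (by positivity)
    linarith
  have k3 : D * (ε * 2 ^ b) < D * (16 * H) := mul_lt_mul_of_pos_left hnum hDpos'
  have k4 : (ε / 192 * D) * 2 ^ b < A * 2 ^ b := by nlinarith
  exact lt_of_mul_lt_mul_right k4 hpb.le
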